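/- arXiv:1508.00124 — 6 statements merged into one kernel-verified Lean document; each statement's English description precedes it below -/
import Mathlib

section
/- Let X be a crowded Polish space and 𝓡 a countable collection of meager relations on X. Then there exists F ⊆ X such that F is dense in X, F is a Baire space in the subspace topology, and F is R-free for every R ∈ 𝓡. Moreover, for any cardinal κ with cof(meager) ≤ κ ≤ 𝔠, one may choose such F with |F| = κ. -/
/-- The cofinality of the meager ideal on the Cantor space `2^ω`. -/
noncomputable def cofMeager : Cardinal :=
  sInf { c | ∃ M : Set (Set (ℕ → Bool)), Cardinal.mk M = c ∧ (∀ s ∈ M, IsMeagre s) ∧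
    ∀ N : Set (ℕ → Bool), IsMeagre N → ∃ s ∈ M, N ⊆ s }

open Set Filter Topology

theorem IsMeagre.exists_seq_dense_open {Y : Type*} [TopologicalSpace Y] [BaireSpace Y]
    {N : Set Y} (hN : IsMeagre N) :
    ∃ D : ℕ → Set Y, (∀ k, IsOpen (D k) ∧ Dense (D k)) ∧ ∀ x, (∀ k, x ∈ D k) → x ∉ N := by
  obtain ⟨t, hts, hG, hd⟩ := mem_residual.1 hN
  obtain ⟨f, hf, rfl⟩ := hG.eq_iInter_nat
  exact ⟨f, fun k => ⟨hf k, hd.mono (iInter_subset _ _)⟩, fun x hx => hts (mem_iInter.2 hx)⟩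

/-- The sets of tuples of binary sequences prescribed below `n` are open. -/
theorem isOpen_setOf_forall_eqOn {α : Type*} [Finite α] (w : α → ℕ → Bool) (n : ℕ) :
    IsOpen {x : α → ℕ → Bool | ∀ a, EqOn (x a) (w a) (Iio n)} := by
  have : {x : α → ℕ → Bool | ∀ a, EqOn (x a) (w a) (Iio n)} =
      ⋂ a, ⋂ i ∈ Iio n, {x | x a i = w a i} := by
    ext x; simp [EqOn]
  rw [this]
  refine isOpen_iInter_of_finite fun a => (finite_Iio n).isOpen_biInter fun i _ => ?_
  have hc : Continuous fun x : α → ℕ → Bool => x a i :=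
    (continuous_apply i).comp (continuous_apply a)
  exact (isOpen_discrete {w a i}).preimage hc

theorem exists_forall_eqOn_subset {α : Type*} [Finite α] {D : Set (α → ℕ → Bool)}
    (hD : IsOpen D) {y : α → ℕ → Bool} (hy : y ∈ D) (m : ℕ) :
    ∃ n, m ≤ n ∧ ∀ x : α → ℕ → Bool, (∀ a, EqOn (x a) (y a) (Iio n)) → x ∈ D := by
  obtain ⟨u, hu, hsub⟩ := isOpen_pi_iff'.1 hD y hy
  have h : ∀ a, ∃ n, PiNat.cylinder (y a) n ⊆ u a := by
    intro a
    obtain ⟨v, ⟨z, n, rfl⟩, hv, hvu⟩ :=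
      (PiNat.isTopologicalBasis_cylinders fun _ : ℕ => Bool).exists_subset_of_mem_open
        (hu a).2 (hu a).1
    exact ⟨n, (PiNat.mem_cylinder_iff_eq.1 hv).symm ▸ hvu⟩
  choose k hk using h
  obtain ⟨M, hM⟩ := (finite_range k).bddAbove
  refine ⟨max m M, le_max_left _ _, fun x hx => hsub fun a _ => hk a ?_⟩
  intro i hi
  exact hx a (lt_of_lt_of_le hi ((hM ⟨a, rfl⟩).trans (le_max_right _ _)))

theorem Dense.exists_extension {α : Type*} [Finite α] {D : Set (α → ℕ → Bool)}
    (hD : IsOpen D) (hd : Dense D) (w : α → ℕ → Bool) (L : ℕ) :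
    ∃ (y : α → ℕ → Bool) (L' : ℕ), L ≤ L' ∧ (∀ a, EqOn (y a) (w a) (Iio L)) ∧
      ∀ x : α → ℕ → Bool, (∀ a, EqOn (x a) (y a) (Iio L')) → x ∈ D := by
  obtain ⟨y, hyw, hyD⟩ := hd.inter_open_nonempty _ (isOpen_setOf_forall_eqOn w L)
    ⟨w, fun a => eqOn_refl _ _⟩
  obtain ⟨L', hL, h⟩ := exists_forall_eqOn_subset hD hyD L
  exact ⟨y, L', hL, hyw, h⟩

/-- Extending `p` beyond `L` so that one tuple, with prescribed values below `l`, enters `D`. -/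
theorem Dense.exists_block_extension {α S : Type*} [Finite α] {D : Set (α → ℕ → Bool)}
    (hD : IsOpen D) (hd : Dense D) {s : α → S} (hs : Function.Injective s)
    (u : α → ℕ → Bool) {l L : ℕ} (hl : l ≤ L) (p : S → ℕ → Bool) :
    ∃ (L' : ℕ) (p' : S → ℕ → Bool), L ≤ L' ∧ (∀ σ, EqOn (p' σ) (p σ) (Iio L)) ∧
      ∀ x : α → ℕ → Bool, (∀ a, EqOn (x a) (u a) (Iio l)) →
        (∀ a, EqOn (x a) (p' (s a)) (Ico l L')) → x ∈ D := by
  classical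
  obtain ⟨y, L', hL, hyw, hy⟩ :=
    hd.exists_extension hD (fun a i => if i < l then u a i else p (s a) i) L
  refine ⟨L', Function.extend s
    (fun a i => if i < l then p (s a) i else y a i) p, hL, ?_, ?_⟩
  · intro σ i hi
    by_cases h : ∃ a, s a = σ
    · obtain ⟨a, rfl⟩ := h
      rw [hs.extend_apply]
      have := hyw a hi
      simp only at this ⊢
      split_ifs with hil
      · rfl
      · simpa [hil] using this
    · rw [Function.extend_apply' _ _ _ h]
  · intro x hxu hxp
    refine hy x fun a i hi => ?_
    by_cases hil : i < l
    · have := hyw a (show i ∈ Iio L from lt_of_lt_of_le hil hl)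
      simp only [hil, if_true] at this
      rw [this, hxu a hil]
    · have := hxp a ⟨not_lt.1 hil, hi⟩
      rw [this, hs.extend_apply]
      simp [hil]

/-- A single block of values, beyond `l`, which forces all injective tuples into finitely many
dense open sets, whatever the values below `l`. -/
theorem exists_block {J : Type*} [Finite J] {α : J → Type*} [∀ j, Finite (α j)]
    {D : ∀ j, Set (α j → ℕ → Bool)} (hD : ∀ j, IsOpen (D j)) (hd : ∀ j, Dense (D j))
    (S : Type*) [Finite S] (l : ℕ) :
    ∃ (L : ℕ) (p : S → ℕ → Bool), l ≤ L ∧ ∀ j (s : α j → S), Function.Injective s →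
      ∀ x : α j → ℕ → Bool, (∀ a, EqOn (x a) (p (s a)) (Ico l L)) → x ∈ D j := by
  classical
  let T := Σ j : J, (α j → S) × (α j → Fin l → Bool)
  have key : ∀ F : Set T, F.Finite → ∃ (L : ℕ) (p : S → ℕ → Bool), l ≤ L ∧
      ∀ t ∈ F, Function.Injective t.2.1 → ∀ x : α t.1 → ℕ → Bool,
        (∀ a (i : Fin l), x a i = t.2.2 a i) →
        (∀ a, EqOn (x a) (p (t.2.1 a)) (Ico l L)) → x ∈ D t.1 := by
    intro F hF
    induction F, hF using Set.Finite.induction_on with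
    | empty => exact ⟨l, fun _ _ => false, le_rfl, by simp⟩
    | @insert t F _ _ ih =>
      obtain ⟨L, p, hL, hp⟩ := ih
      by_cases hs : Function.Injective t.2.1
      · obtain ⟨L', p', hL', hpp', hp'⟩ := (hd t.1).exists_block_extension (hD t.1) hs
          (fun a i => if h : i < l then t.2.2 a ⟨i, h⟩ else false) hL p
        refine ⟨L', p', hL.trans hL', ?_⟩
        rintro t' (rfl | ht') hinj x hxu hxp
        · refine hp' x (fun a i hi => ?_) hxp
          have hi' : i < l := hi
          simpa [hi'] using hxu a ⟨i, hi⟩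
        · refine hp t' ht' hinj x hxu fun a i hi => ?_
          rw [hxp a ⟨hi.1, hi.2.trans_le hL'⟩, hpp' _ hi.2]
      · refine ⟨L, p, hL, ?_⟩
        rintro t' (rfl | ht') hinj
        · exact absurd hinj hs
        · exact hp t' ht' hinj
  obtain ⟨L, p, hL, hp⟩ := key univ finite_univ
  exact ⟨L, p, hL, fun j s hs x hx =>
    hp ⟨j, s, fun a i => x a i⟩ (mem_univ _) hs x (fun _ _ => rfl) hx⟩

/-- Consecutive blocks with endpoints in the range of `A`, such that the `n`-th block forces
all injective tuples into each dense open set of code at most `n`. -/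
theorem exists_seq_block {J : Type*} {e : J → ℕ} (he : Function.Injective e)
    {α : J → Type*} [∀ j, Finite (α j)]
    {D : ∀ j, Set (α j → ℕ → Bool)} (hD : ∀ j, IsOpen (D j)) (hd : ∀ j, Dense (D j))
    (S : ℕ → Type) [∀ n, Finite (S n)] {A : ℕ → ℕ} (hA : StrictMono A) :
    ∃ (ν : ℕ → ℕ) (p : ∀ n, S n → ℕ → Bool), StrictMono ν ∧
      ∀ n j, e j ≤ n → ∀ s : α j → S n, Function.Injective s →
        ∀ x : α j → ℕ → Bool,
          (∀ a, EqOn (x a) (p n (s a)) (Ico (A (ν n)) (A (ν (n + 1))))) → x ∈ D j := by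
  have step : ∀ n k : ℕ, ∃ (k' : ℕ) (p : S n → ℕ → Bool), k < k' ∧
      ∀ j, e j ≤ n → ∀ s : α j → S n, Function.Injective s → ∀ x : α j → ℕ → Bool,
        (∀ a, EqOn (x a) (p (s a)) (Ico (A k) (A k'))) → x ∈ D j := by
    intro n k
    have : Finite {j // e j ≤ n} :=
      Finite.of_injective (fun j : {j // e j ≤ n} => (⟨e j, Nat.lt_succ_of_le j.2⟩ : Fin (n + 1)))
        fun i j h => Subtype.ext (he (by simpa using h))
    obtain ⟨L, p, hL, hp⟩ := exists_block (J := {j // e j ≤ n}) (fun j => hD j) (fun j => hd j)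
      (S n) (A k)
    refine ⟨max (k + 1) L, p, by simp, fun j hj s hs x hx => hp ⟨j, hj⟩ s hs x fun a => ?_⟩
    exact (hx a).mono (Ico_subset_Ico_right ((le_max_right _ _).trans (hA.id_le _)))
  choose k' p hlt hp using step
  let ν : ℕ → ℕ := Nat.rec 0 fun n k => k' n k
  exact ⟨ν, fun n => p n (ν n), strictMono_nat_of_lt_succ fun n => hlt n (ν n),
    fun n => hp n (ν n)⟩

theorem StrictMono.exists_index {l : ℕ → ℕ} (hl : StrictMono l) :
    ∃ b : ℕ → ℕ, ∀ n i, i ∈ Ico (l n) (l (n + 1)) → b i = n := by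
  refine ⟨fun i => sSup {n | l n ≤ i}, fun n i hi => ?_⟩
  have : {n | l n ≤ i} = Iic n := by
    ext m
    refine ⟨fun hm => ?_, fun hm => (hl.monotone hm).trans hi.1⟩
    by_contra h
    exact (hi.2.trans_le (hl.monotone (Nat.succ_le_of_lt (not_le.1 h)))).not_ge hm
  simp [this]

/-- A meagre set of binary sequences can be avoided by prescribing values on a small set
of blocks. -/
theorem IsMeagre.exists_small_avoiding {l : ℕ → ℕ} (hl : StrictMono l)
    {b : ℕ → ℕ} (hb : ∀ n i, i ∈ Ico (l n) (l (n + 1)) → b i = n) (U : Ultrafilter ℕ)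
    {N : Set (ℕ → Bool)} (hN : IsMeagre N) :
    ∃ (B : Set ℕ) (z : ℕ → Bool), B ∉ U ∧ ∀ (h : ℕ) (x : ℕ → Bool),
      (∀ i, h ≤ i → b i ∈ B → x i = z i) → x ∉ N := by
  obtain ⟨D, hD, hDN⟩ := hN.exists_seq_dense_open
  let φ := Homeomorph.funUnique Unit (ℕ → Bool)
  obtain ⟨ν, p, hν, hp⟩ := exists_seq_block (J := ℕ) (e := id) Function.injective_id
    (α := fun _ => Unit) (D := fun j => φ ⁻¹' D j) (fun j => (hD j).1.preimage φ.continuous)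
    (fun j => (hD j).2.preimage φ.isOpenMap) (fun _ => Unit) hl
  obtain ⟨c, hc⟩ := hν.exists_index
  obtain ⟨d, hd⟩ := (hl.comp hν).exists_index
  let z : ℕ → Bool := fun i => p (d i) () i
  have hsmall : ∃ r : ℕ, ({n | c n % 2 = r % 2} : Set ℕ) ∉ U := by
    by_contra! hcon
    obtain ⟨n, hn0, hn1⟩ := U.nonempty_of_mem (inter_mem (hcon 0) (hcon 1))
    simp only [mem_ofPred_eq] at hn0 hn1
    omega
  obtain ⟨r, hr⟩ := hsmall
  refine ⟨_, z, hr, fun h x hx => hDN x fun k => ?_⟩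
  let m := 2 * (k + h) + r
  refine hp m k (by simp only [id, m]; omega) id Function.injective_id (fun _ => x) fun _ i hi => ?_
  have hhi : h ≤ i := by
    have h1 := (hl.comp hν).id_le m
    simp only [id, Function.comp, m] at h1
    have h2 := hi.1
    simp only [m] at h2
    omega
  have hdi : d i = m := hd m i hi
  obtain ⟨q, hq⟩ : ∃ q, i ∈ Ico (l q) (l (q + 1)) := by
    have hex : ∃ q, i < l q := ⟨_, hi.2⟩
    classical
    have h1 := Nat.find_spec hex
    have h2 : Nat.find hex ≠ 0 := fun h0 => by
      rw [h0] at h1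
      exact absurd ((hl.monotone (Nat.zero_le _)).trans hi.1) (not_le.2 h1)
    obtain ⟨q, hq⟩ := Nat.exists_eq_succ_of_ne_zero h2
    refine ⟨q, not_lt.1 (Nat.find_min hex (by omega)), ?_⟩
    rw [hq] at h1
    exact h1
  have hqm : q ∈ Ico (ν m) (ν (m + 1)) := by
    constructor
    · by_contra hlt
      exact absurd (hq.2.trans_le (hl.monotone (not_le.1 hlt))) (not_lt.2 hi.1)
    · exact hl.lt_iff_lt.1 (hq.1.trans_lt hi.2)
  have hmem : b i ∈ {n | c n % 2 = r % 2} := by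
    rw [hb q i hq, mem_ofPred_eq, hc m q hqm]
    simp only [m]; omega
  rw [hx i hhi hmem]
  simp only [z, hdi, id]

theorem eventually_injective_restrict {α T : Type*} [Finite α] {y : T → ℕ → Bool}
    (hy : Function.Injective y) {τ : α → T} (hτ : Function.Injective τ) :
    ∀ᶠ n in atTop, Function.Injective fun a (i : Fin n) => y (τ a) i := by
  have : ∀ a a', ∀ᶠ n in atTop, a ≠ a' →
      (fun i : Fin n => y (τ a) i) ≠ fun i : Fin n => y (τ a') i := by
    intro a a'
    by_cases h : a = a'
    · simp [h]
    · obtain ⟨i, hi⟩ := Function.ne_iff.1 (hy.ne (hτ.ne h))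
      filter_upwards [eventually_gt_atTop i] with n hn _ heq
      exact hi (congrFun heq ⟨i, hn⟩)
  have := eventually_all.2 fun a => eventually_all.2 (this a)
  filter_upwards [this] with n hn a a' haa
  by_contra hne
  exact hn a a' hne haa

/-- Given countably many meagre relations on the Cantor space, any at most continuum-sized
family of requirements, each to belong to a cylinder and to avoid a meagre set, can be met by
points which are free for the relations. -/
theorem exists_free_family {ι : Type} [Countable ι] (n : ι → ℕ)
    {R : ∀ i, Set (Fin (n i) → ℕ → Bool)} (hR : ∀ i, IsMeagre (R i))
    {T : Type} {y : T → ℕ → Bool} (hy : Function.Injective y)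
    {N : T → Set (ℕ → Bool)} (hN : ∀ t, IsMeagre (N t)) (u : T → ℕ → Bool) (h : T → ℕ) :
    ∃ x : T → ℕ → Bool, (∀ t, EqOn (x t) (u t) (Iio (h t))) ∧ (∀ t, x t ∉ N t) ∧
      ∀ i (τ : Fin (n i) → T), Function.Injective τ → (fun a => x (τ a)) ∉ R i := by
  classical
  choose D hD hDR using fun i => (hR i).exists_seq_dense_open
  obtain ⟨e, he⟩ := exists_injective_nat (ι × ℕ)
  obtain ⟨l, p, hl, hp⟩ := exists_seq_block he (α := fun j => Fin (n j.1))
    (D := fun j => D j.1 j.2) (fun j => (hD j.1 j.2).1) (fun j => (hD j.1 j.2).2)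
    (fun m => Fin m → Bool) strictMono_id
  obtain ⟨b, hb⟩ := hl.exists_index
  choose B z hB hz using fun t => (hN t).exists_small_avoiding hl hb (hyperfilter ℕ)
  let x : T → ℕ → Bool := fun t i =>
    if i < h t then u t i else if b i ∈ B t then z t i else p (b i) (fun a => y t a) i
  refine ⟨x, fun t i hi => if_pos hi, fun t => hz t (h t) _ fun i hi hbi => ?_,
    fun i τ hτ => hDR i _ fun k => ?_⟩
  · simp [x, not_lt.2 hi, hbi]
  · have h1 : ∀ᶠ m in (hyperfilter ℕ : Filter ℕ), ∀ a, m ∉ B (τ a) :=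
      eventually_all.2 fun a => Ultrafilter.compl_mem_iff_notMem.2 (hB (τ a))
    have h2 : ∀ᶠ m in (hyperfilter ℕ : Filter ℕ), (∀ a, h (τ a) ≤ m) ∧ e (i, k) ≤ m ∧
        Function.Injective fun a (i : Fin m) => y (τ a) i :=
      Nat.hyperfilter_le_atTop ((eventually_all.2 fun a => eventually_ge_atTop _).and
        ((eventually_ge_atTop _).and (eventually_injective_restrict hy hτ)))
    obtain ⟨m, hmB, hmh, hme, hinj⟩ := (h1.and h2).exists
    refine hp m (i, k) hme _ hinj _ fun a q hq => ?_
    have hbq := hb m q hq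
    have hhq : ¬ q < h (τ a) := not_lt.2 ((hmh a).trans ((hl.id_le m).trans hq.1))
    have hnB : b q ∉ B (τ a) := hbq ▸ hmB a
    simp only [x, hhq, hnB, if_false]
    rw [hbq]

section Scheme

variable {X : Type*} [TopologicalSpace X]

/-- The `n`-th open set attached to the binary sequence `x`: at each digit `1` we move on to the
current member of the list `e`, if its closure lies in the current open set. -/
def schemeSet (e : ℕ → Set X) (x : ℕ → Bool) : ℕ → Set X
  | 0 => univ
  | n + 1 => {p | (x n = true ∧ closure (e n) ⊆ schemeSet e x n ∧ p ∈ e n) ∨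
      (¬ (x n = true ∧ closure (e n) ⊆ schemeSet e x n) ∧ p ∈ schemeSet e x n)}

variable {e : ℕ → Set X}

theorem schemeSet_succ_of_pos {x : ℕ → Bool} {n : ℕ}
    (h : x n = true ∧ closure (e n) ⊆ schemeSet e x n) : schemeSet e x (n + 1) = e n := by
  ext p; simp [schemeSet, h]

theorem schemeSet_succ_of_neg {x : ℕ → Bool} {n : ℕ}
    (h : ¬ (x n = true ∧ closure (e n) ⊆ schemeSet e x n)) :
    schemeSet e x (n + 1) = schemeSet e x n := by
  ext p
  simp only [schemeSet, mem_ofPred_eq, h, not_false_eq_true, true_and]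
  tauto

theorem schemeSet_antitone (e : ℕ → Set X) (x : ℕ → Bool) : Antitone (schemeSet e x) := by
  refine antitone_nat_of_succ_le fun n => ?_
  by_cases h : x n = true ∧ closure (e n) ⊆ schemeSet e x n
  · rw [schemeSet_succ_of_pos h]
    exact subset_closure.trans h.2
  · rw [schemeSet_succ_of_neg h]

theorem isOpen_schemeSet (he : ∀ n, IsOpen (e n)) (x : ℕ → Bool) (n : ℕ) :
    IsOpen (schemeSet e x n) := by
  induction n with
  | zero => exact isOpen_univ
  | succ n ih =>
    by_cases h : x n = true ∧ closure (e n) ⊆ schemeSet e x n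
    · rw [schemeSet_succ_of_pos h]; exact he n
    · rw [schemeSet_succ_of_neg h]; exact ih

theorem schemeSet_nonempty [Nonempty X] (he : ∀ n, (e n).Nonempty) (x : ℕ → Bool) (n : ℕ) :
    (schemeSet e x n).Nonempty := by
  induction n with
  | zero => exact univ_nonempty
  | succ n ih =>
    by_cases h : x n = true ∧ closure (e n) ⊆ schemeSet e x n
    · rw [schemeSet_succ_of_pos h]; exact he n
    · rw [schemeSet_succ_of_neg h]; exact ih

theorem schemeSet_congr {x x' : ℕ → Bool} {n : ℕ} (h : EqOn x x' (Iio n)) :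
    schemeSet e x n = schemeSet e x' n := by
  induction n with
  | zero => rfl
  | succ n ih =>
    have h1 := ih (h.mono (Iio_subset_Iio n.le_succ))
    have h2 : x n = x' n := h n.lt_succ_self
    simp only [schemeSet, h1, h2]

theorem schemeSet_eq_of_forall_false {x : ℕ → Bool} {n m : ℕ} (hnm : n ≤ m)
    (h : ∀ i ∈ Ico n m, x i = false) : schemeSet e x m = schemeSet e x n := by
  induction m, hnm using Nat.le_induction with
  | base => rfl
  | succ m hm ih =>
    rw [schemeSet_succ_of_neg, ih fun i hi => h i ⟨hi.1, hi.2.trans m.lt_succ_self⟩]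
    simp [h m ⟨hm, m.lt_succ_self⟩]

/-- Any finite sequence can be extended so as to shrink its open set into a given open set. -/
theorem exists_schemeSet_closure_subset
    (hbasis : ∀ V : Set X, IsOpen V → V.Nonempty → ∀ n, ∃ m, n ≤ m ∧ closure (e m) ⊆ V)
    (he : ∀ n, IsOpen (e n)) (w : ℕ → Bool) (n : ℕ) {V : Set X} (hV : IsOpen V)
    (hne : (V ∩ schemeSet e w n).Nonempty) :
    ∃ (w' : ℕ → Bool) (m : ℕ), n ≤ m ∧ EqOn w' w (Iio n) ∧ closure (schemeSet e w' m) ⊆ V := by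
  obtain ⟨m, hnm, hm⟩ := hbasis _ (hV.inter (isOpen_schemeSet he w n)) hne n
  let w' : ℕ → Bool := fun i => if i < n then w i else decide (i = m)
  have hw : EqOn w' w (Iio n) := fun i hi => if_pos hi
  refine ⟨w', m + 1, by omega, hw, ?_⟩
  have h1 : schemeSet e w' m = schemeSet e w n := by
    rw [schemeSet_eq_of_forall_false hnm, schemeSet_congr hw]
    intro i hi
    simp [w', not_lt.2 hi.1, hi.2.ne]
  rw [schemeSet_succ_of_pos]
  · exact hm.trans inter_subset_left
  · exact ⟨by simp [w', not_lt.2 hnm], h1 ▸ hm.trans inter_subset_right⟩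

/-- The tuples of binary sequences whose open sets eventually avoid a closed nowhere dense set
contain a comeagre set. -/
theorem isMeagre_forall_schemeSet_meets [Nonempty X]
    (hbasis : ∀ V : Set X, IsOpen V → V.Nonempty → ∀ n, ∃ m, n ≤ m ∧ closure (e m) ⊆ V)
    (he : ∀ n, IsOpen (e n)) (hne : ∀ n, (e n).Nonempty) {α : Type*} [Finite α]
    {C : Set (α → X)} (hC : IsNowhereDense C) :
    IsMeagre {x : α → ℕ → Bool | ∀ n, ∃ q ∈ C, ∀ a, q a ∈ closure (schemeSet e (x a) n)} := by
  refine residual_of_dense_open ?_ ?_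
  · refine isOpen_iff_mem_nhds.2 fun x hx => ?_
    simp only [mem_compl_iff, mem_ofPred_eq, not_forall] at hx
    obtain ⟨n, hn⟩ := hx
    refine mem_of_superset ((isOpen_setOf_forall_eqOn x n).mem_nhds fun a => eqOn_refl _ _) ?_
    intro x' hx' hcon
    obtain ⟨q, hq, hqn⟩ := hcon n
    exact hn ⟨q, hq, fun a => schemeSet_congr (e := e) (hx' a) ▸ hqn a⟩
  · refine dense_iff_inter_open.2 fun O hO ⟨x, hx⟩ => ?_
    obtain ⟨n, -, hn⟩ := exists_forall_eqOn_subset hO hx 0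
    have hopen : IsOpen (univ.pi fun a => schemeSet e (x a) n) :=
      isOpen_set_pi finite_univ fun a _ => isOpen_schemeSet he (x a) n
    have hnonempty : (univ.pi fun a => schemeSet e (x a) n).Nonempty :=
      univ_pi_nonempty_iff.2 fun a => schemeSet_nonempty hne (x a) n
    have hdense : Dense (closure C)ᶜ := interior_eq_empty_iff_dense_compl.1 hC
    obtain ⟨q, hq, hqC⟩ := hdense.inter_open_nonempty _ hopen hnonempty
    obtain ⟨v, hv, hvC⟩ := isOpen_pi_iff'.1 isClosed_closure.isOpen_compl q hqC
    choose w m hm hw hwv using fun a => exists_schemeSet_closure_subset hbasis he (x a) n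
      (hv a).1 ⟨q a, (hv a).2, hq a (mem_univ a)⟩
    obtain ⟨M, hM⟩ := (finite_range m).bddAbove
    refine ⟨w, hn w hw, fun hcon => ?_⟩
    obtain ⟨r, hr, hrM⟩ := hcon M
    refine hvC (fun a _ => hwv a ?_) (subset_closure hr)
    exact closure_mono (schemeSet_antitone e (w a) (hM ⟨a, rfl⟩)) (hrM a)

end Scheme

/-- Every Polish space is the image of the Cantor space under a map such that the preimages of
meagre sets of tuples are meagre and the preimages of nonempty open sets contain a cylinder
up to a meagre set. -/
theorem exists_category_preserving_map (X : Type*) [TopologicalSpace X] [PolishSpace X]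
    [Nonempty X] :
    ∃ f : (ℕ → Bool) → X,
      (∀ (α : Type) [Finite α] (R : Set (α → X)), IsMeagre R →
        IsMeagre {x : α → ℕ → Bool | (fun a => f (x a)) ∈ R}) ∧
      ∃ G : Set (ℕ → Bool), IsMeagre Gᶜ ∧ ∀ V : Set X, IsOpen V → V.Nonempty →
        ∃ (w : ℕ → Bool) (n : ℕ), ∀ x ∈ G, EqOn x w (Iio n) → f x ∈ V := by
  let _ := TopologicalSpace.upgradeIsCompletelyMetrizable X
  have : Nonempty (TopologicalSpace.countableBasis X) := by
    obtain ⟨v, hv, -⟩ := (TopologicalSpace.isBasis_countableBasis X).exists_subset_of_mem_open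
      (mem_univ (Classical.arbitrary X)) isOpen_univ
    exact ⟨v, hv⟩
  obtain ⟨b, hb⟩ := exists_surjective_nat (TopologicalSpace.countableBasis X)
  let e : ℕ → Set X := fun n => b n.unpair.1
  have he : ∀ n, IsOpen (e n) := fun n =>
    TopologicalSpace.isOpen_of_mem_countableBasis (b n.unpair.1).2
  have hne : ∀ n, (e n).Nonempty := fun n =>
    TopologicalSpace.nonempty_of_mem_countableBasis (b n.unpair.1).2
  have hbasis : ∀ V : Set X, IsOpen V → V.Nonempty → ∀ n, ∃ m, n ≤ m ∧ closure (e m) ⊆ V := by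
    rintro V hV ⟨p, hp⟩ n
    obtain ⟨W, hW, hWc, hWV⟩ := exists_mem_nhds_isClosed_subset (hV.mem_nhds hp)
    obtain ⟨v, hv, -, hvW⟩ := (TopologicalSpace.isBasis_countableBasis X).mem_nhds_iff.1 hW
    obtain ⟨k, hk⟩ := hb ⟨v, hv⟩
    refine ⟨Nat.pair k n, Nat.right_le_pair k n, ?_⟩
    have : e (Nat.pair k n) = v := by simp [e, hk]
    rw [this]
    exact (closure_minimal hvW hWc).trans hWV
  let G : Set (ℕ → Bool) := {x | ∃ p, ∀ n, p ∈ closure (schemeSet e x n)}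
  have hG : IsMeagre Gᶜ := by
    have hk : ∀ k : ℕ, IsMeagre
        {x : ℕ → Bool | ¬ ∃ n q, schemeSet e x n ⊆ Metric.ball q (1 / (k + 1))} := by
      intro k
      refine residual_of_dense_open ?_ ?_
      · refine isOpen_iff_mem_nhds.2 fun x hx => ?_
        simp only [mem_compl_iff, mem_ofPred_eq, not_not] at hx
        obtain ⟨n, q, hq⟩ := hx
        refine mem_of_superset ((PiNat.isOpen_cylinder _ x n).mem_nhds
          (PiNat.self_mem_cylinder x n)) fun x' hx' => ?_
        simp only [mem_compl_iff, mem_ofPred_eq, not_not]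
        exact ⟨n, q, schemeSet_congr (e := e) (fun i hi => hx' i hi) ▸ hq⟩
      · refine dense_iff_inter_open.2 fun O hO ⟨x, hx⟩ => ?_
        obtain ⟨v, ⟨z, n, rfl⟩, hv, hvu⟩ :=
          (PiNat.isTopologicalBasis_cylinders fun _ : ℕ => Bool).exists_subset_of_mem_open hx hO
        obtain ⟨q, hq⟩ := schemeSet_nonempty hne z n
        obtain ⟨w, m, -, hw, hwm⟩ := exists_schemeSet_closure_subset hbasis he z n
          (Metric.isOpen_ball (x := q) (ε := 1 / ((k : ℝ) + 1)))
          ⟨q, Metric.mem_ball_self (by positivity), hq⟩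
        refine ⟨w, hvu fun i hi => hw hi, ?_⟩
        simp only [mem_compl_iff, mem_ofPred_eq, not_not]
        exact ⟨m, q, subset_closure.trans hwm⟩
    refine (isMeagre_iUnion hk).mono fun x hx => ?_
    by_contra hcon
    simp only [mem_iUnion, mem_ofPred_eq, not_exists] at hcon
    push Not at hcon
    refine hx ?_
    choose s hs using fun n => schemeSet_nonempty hne x n
    have hcauchy : CauchySeq s := by
      refine Metric.cauchySeq_iff.2 fun ε hε => ?_
      obtain ⟨k, hk⟩ := exists_nat_one_div_lt (half_pos hε)
      obtain ⟨n, q, hq⟩ := hcon k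
      refine ⟨n, fun i hi j hj => ?_⟩
      have h1 := hq (schemeSet_antitone e x hi (hs i))
      have h2 := hq (schemeSet_antitone e x hj (hs j))
      rw [Metric.mem_ball] at h1 h2
      linarith [dist_triangle_right (s i) (s j) q]
    obtain ⟨p, hp⟩ := cauchySeq_tendsto_of_complete hcauchy
    exact ⟨p, fun n => mem_closure_of_tendsto hp
      ((eventually_ge_atTop n).mono fun i hi => schemeSet_antitone e x hi (hs i))⟩
  classical
  let f : (ℕ → Bool) → X := fun x => if h : x ∈ G then h.choose else Classical.arbitrary X
  have hf : ∀ x ∈ G, ∀ n, f x ∈ closure (schemeSet e x n) := by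
    intro x hx
    simp only [f, dif_pos hx]
    exact hx.choose_spec
  refine ⟨f, fun α _ R hR => ?_, G, hG, fun V hV hVne => ?_⟩
  · obtain ⟨S, hS, hSc, hRS⟩ := isMeagre_iff_countable_union_isNowhereDense.1 hR
    have h1 : IsMeagre (⋃ a : α, (fun x : α → ℕ → Bool => x a) ⁻¹' Gᶜ) :=
      isMeagre_iUnion fun a => hG.preimage_of_isOpenMap (continuous_apply a) (isOpenMap_eval a)
    refine (h1.union (isMeagre_biUnion hSc fun C hC =>
      isMeagre_forall_schemeSet_meets hbasis he hne (hS C hC))).mono fun x hx => ?_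
    obtain ⟨C, hC, hxC⟩ := hRS hx
    by_cases hxG : ∀ a, x a ∈ G
    · exact Or.inr (mem_biUnion hC fun n => ⟨_, hxC, fun a => hf _ (hxG a) n⟩)
    · obtain ⟨a, ha⟩ := not_forall.1 hxG
      exact Or.inl (mem_iUnion.2 ⟨a, ha⟩)
  · obtain ⟨w, m, -, -, hw⟩ := exists_schemeSet_closure_subset hbasis he (fun _ => false) 0 hV
      (by simpa [schemeSet] using hVne)
    exact ⟨w, m, fun x hx hxw => hw (schemeSet_congr (e := e) hxw ▸ hf x hx m)⟩

theorem isMeagre_setOf_apply_eq {X : Type*} [TopologicalSpace X] [T2Space X]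
    (hX : Preperfect (univ : Set X)) : IsMeagre {x : Fin 2 → X | x 0 = x 1} := by
  have hclosed : IsClosed {x : Fin 2 → X | x 0 = x 1} :=
    isClosed_eq (continuous_apply 0) (continuous_apply 1)
  refine IsNowhereDense.isMeagre (hclosed.isNowhereDense_iff.2 ?_)
  refine interior_eq_empty_iff_dense_compl.2 (dense_iff_inter_open.2 fun O hO ⟨x, hx⟩ => ?_)
  obtain ⟨u, hu, hsub⟩ := isOpen_pi_iff'.1 hO x hx
  obtain ⟨y, ⟨hy, -⟩, hyx⟩ := preperfect_iff_nhds.1 hX (x 1) (mem_univ _) (u 1)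
    ((hu 1).1.mem_nhds (hu 1).2)
  by_cases h : x 0 = x 1
  · refine ⟨![x 0, y], hsub fun a _ => ?_, fun heq => hyx ?_⟩
    · fin_cases a
      · exact (hu 0).2
      · exact hy
    · have heq' : x 0 = y := heq
      rw [← heq', h]
  · exact ⟨x, hx, h⟩

theorem exists_cofinal_meagre_mk_eq_cofMeager :
    ∃ M : Set (Set (ℕ → Bool)), Cardinal.mk M = cofMeager ∧ (∀ s ∈ M, IsMeagre s) ∧
      ∀ N : Set (ℕ → Bool), IsMeagre N → ∃ s ∈ M, N ⊆ s :=
  csInf_mem (s := { c | ∃ M : Set (Set (ℕ → Bool)), Cardinal.mk M = c ∧ (∀ s ∈ M, IsMeagre s) ∧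
    ∀ N : Set (ℕ → Bool), IsMeagre N → ∃ s ∈ M, N ⊆ s })
    ⟨_, {s | IsMeagre s}, rfl, fun _ hs => hs, fun N hN => ⟨N, hN, Subset.rfl⟩⟩

theorem cofMeager_le_continuum : cofMeager ≤ Cardinal.continuum := by
  let M : Set (Set (ℕ → Bool)) := {s | (borel (ℕ → Bool)).MeasurableSet' s ∧ IsMeagre s}
  have hM : cofMeager ≤ Cardinal.mk M := by
    refine csInf_le' ⟨M, rfl, fun s hs => hs.2, fun N hN => ?_⟩
    obtain ⟨t, hts, hG, hd⟩ := mem_residual.1 hN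
    borelize (ℕ → Bool)
    refine ⟨tᶜ, ⟨hG.measurableSet.compl, ?_⟩, subset_compl_comm.1 hts⟩
    rw [IsMeagre, compl_compl]
    exact residual_of_dense_Gδ hG hd
  refine hM.trans ((Cardinal.mk_le_mk_of_subset fun s hs => hs.1).trans
    (?_ : Cardinal.mk {s | (borel (ℕ → Bool)).MeasurableSet' s} ≤ _))
  rw [(TopologicalSpace.isBasis_countableBasis (ℕ → Bool)).borel_eq_generateFrom]
  exact MeasurableSpace.cardinal_measurableSet_le_continuum
    ((TopologicalSpace.countable_countableBasis _).le_aleph0.trans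
      Cardinal.aleph0_le_continuum)

theorem aleph0_le_cofMeager : Cardinal.aleph0 ≤ cofMeager := by
  obtain ⟨M, hM, hmeagre, hcof⟩ := exists_cofinal_meagre_mk_eq_cofMeager
  by_contra! hlt
  rw [← hM] at hlt
  have hMc : M.Countable := Cardinal.le_aleph0_iff_set_countable.1 hlt.le
  obtain ⟨p, hp⟩ := (dense_of_mem_residual (isMeagre_biUnion hMc hmeagre)).nonempty
  have hsing : IsMeagre ({p} : Set (ℕ → Bool)) := by
    have : (𝓝[≠] p).NeBot := by
      refine mem_closure_iff_nhdsWithin_neBot.1 ?_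
      refine (PiNat.isTopologicalBasis_cylinders fun _ : ℕ => Bool).mem_closure_iff.2 ?_
      rintro _ ⟨z, n, rfl⟩ hpz
      refine ⟨Function.update p n (!p n), fun i hi => ?_, fun h => ?_⟩
      · rw [Function.update_of_ne hi.ne]; exact hpz i hi
      · have := congrFun (h : _ = p) n
        simp at this
    exact (isClosed_singleton.isNowhereDense_iff.2 (interior_singleton p)).isMeagre
  obtain ⟨s, hs, hps⟩ := hcof _ hsing
  exact hp (mem_biUnion hs (hps rfl))

/-- A set which meets every nonempty open set outside every meagre set is a Baire space. -/
theorem baireSpace_of_forall_exists_notMem {X : Type*} [TopologicalSpace X] {F : Set X}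
    (hF : ∀ V : Set X, IsOpen V → V.Nonempty → ∀ N : Set X, IsMeagre N → ∃ x ∈ F, x ∈ V ∧ x ∉ N) :
    Dense F ∧ BaireSpace F := by
  have hdense : Dense F := dense_iff_inter_open.2 fun V hV hne =>
    let ⟨x, hxF, hxV, _⟩ := hF V hV hne ∅ IsMeagre.empty
    ⟨x, hxV, hxF⟩
  refine ⟨hdense, ⟨fun D hD hd => dense_iff_inter_open.2 ?_⟩⟩
  rintro _ ⟨V, hV, rfl⟩ ⟨y, hy⟩
  choose W hW hWD using fun n => isOpen_induced_iff.1 (hD n)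
  have hWd : ∀ n, Dense (W n) := fun n => by
    refine (hdense.denseRange_val.dense_image continuous_subtype_val (hd n)).mono ?_
    rintro _ ⟨x, hx, rfl⟩
    rw [← hWD n] at hx
    exact hx
  obtain ⟨x, hxF, hxV, hx⟩ := hF V hV ⟨y, hy⟩ (⋃ n, (W n)ᶜ) (isMeagre_iUnion fun n => by
    rw [IsMeagre, compl_compl]
    exact residual_of_dense_open (hW n) (hWd n))
  refine ⟨⟨x, hxF⟩, hxV, mem_iInter.2 fun n => ?_⟩
  rw [← hWD n]
  by_contra hn
  exact hx (mem_iUnion.2 ⟨n, hn⟩)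

theorem exists_free_baire_mk_eq {X : Type} [TopologicalSpace X] [PolishSpace X] [Nonempty X]
    (hX : Preperfect (univ : Set X)) {ι : Type} [Countable ι] (n : ι → ℕ)
    (R : ∀ i, Set (Fin (n i) → X)) (hR : ∀ i, IsMeagre (R i)) {κ : Cardinal}
    (hκ : cofMeager ≤ κ) (hκc : κ ≤ Cardinal.continuum) :
    ∃ F : Set X, Dense F ∧ BaireSpace F ∧ Cardinal.mk F = κ ∧
      ∀ i (x : Fin (n i) → X), Function.Injective x → (∀ k, x k ∈ F) → x ∉ R i := by
  classical
  obtain ⟨M, hM, hmeagre, hcof⟩ := exists_cofinal_meagre_mk_eq_cofMeager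
  obtain ⟨f, hf, G, hG, hfG⟩ := exists_category_preserving_map X
  have hκ0 : Cardinal.aleph0 ≤ κ := aleph0_le_cofMeager.trans hκ
  let T : Type := (M × κ.out) × (Finset ℕ × ℕ)
  have hMne : Cardinal.mk M ≠ 0 := by
    rw [hM]; exact (Cardinal.aleph0_pos.trans_le aleph0_le_cofMeager).ne'
  have hT : Cardinal.mk T = κ := by
    have h1 : Cardinal.mk (M × κ.out) = κ := by
      rw [Cardinal.mk_prod, Cardinal.lift_id, Cardinal.lift_id, Cardinal.mk_out]
      exact Cardinal.mul_eq_right hκ0 (hM.trans_le hκ) hMne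
    have h2 : Cardinal.mk (Finset ℕ × ℕ) = Cardinal.aleph0 := Cardinal.mk_eq_aleph0 _
    rw [show Cardinal.mk T = Cardinal.mk (M × κ.out) * Cardinal.mk (Finset ℕ × ℕ) by
      simp [T], h1, h2]
    exact Cardinal.mul_aleph0_eq hκ0
  obtain ⟨y⟩ : Nonempty (T ↪ (ℕ → Bool)) := by
    rw [← Cardinal.le_def, hT]
    simpa using hκc
  obtain ⟨x, hxu, hxN, hxR⟩ := exists_free_family
    (fun i : Option ι => i.elim 2 n)
    (R := fun i => match i with
      | none => {v | f (v (0 : Fin 2)) = f (v (1 : Fin 2))}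
      | some i => {v | (fun a => f (v a)) ∈ R i})
    (fun i => match i with
      | none => hf (Fin 2) _ (isMeagre_setOf_apply_eq hX)
      | some i => hf _ _ (hR i))
    y.injective (N := fun t => t.1.1) (fun t => hmeagre _ t.1.1.2)
    (fun t i => decide (i ∈ t.2.1)) (fun t => t.2.2)
  have hinj : Function.Injective fun t => f (x t) := by
    intro t t' h
    by_contra hne
    refine hxR none ![t, t'] ?_ h
    intro a a' haa
    fin_cases a <;> fin_cases a' <;> first | rfl | exact absurd haa hne | exact absurd haa.symm hne
  have hF : ∀ V : Set X, IsOpen V → V.Nonempty → ∀ N : Set X, IsMeagre N →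
      ∃ p ∈ range fun t => f (x t), p ∈ V ∧ p ∉ N := by
    intro V hV hVne N hN
    obtain ⟨w, m, hw⟩ := hfG V hV hVne
    have hN' : IsMeagre {z : ℕ → Bool | f z ∈ N} := by
      let φ := Homeomorph.funUnique Unit X
      let ψ := Homeomorph.funUnique Unit (ℕ → Bool)
      have h1 := hf Unit _ (hN.preimage_of_isOpenMap φ.continuous φ.isOpenMap)
      exact h1.preimage_of_isOpenMap ψ.symm.continuous ψ.symm.isOpenMap
    obtain ⟨s, hs, hsub⟩ := hcof _ (hG.union hN')
    obtain ⟨k⟩ : Nonempty κ.out := Cardinal.mk_ne_zero_iff.1 (by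
      rw [Cardinal.mk_out]; exact (Cardinal.aleph0_pos.trans_le hκ0).ne')
    let t : T := ((⟨s, hs⟩, k), ((Finset.range m).filter fun i => w i = true, m))
    have ht : x t ∉ s := hxN t
    refine ⟨_, ⟨t, rfl⟩, hw _ ?_ fun i hi => ?_, fun h => ht (hsub (Or.inr h))⟩
    · by_contra h
      exact ht (hsub (Or.inl h))
    · have hi' : i < m := hi
      rw [hxu t hi]
      simp [t, hi']
  obtain ⟨hd, hb⟩ := baireSpace_of_forall_exists_notMem hF
  refine ⟨_, hd, hb, (Cardinal.mk_range_eq _ hinj).trans hT, fun i v hv hvF hvR => ?_⟩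
  choose τ hτ using hvF
  refine hxR (some i) τ (fun a a' h => hv ?_) ?_
  · rw [← hτ a, ← hτ a', h]
  · have : (fun a => f (x (τ a))) = v := funext hτ
    exact (this ▸ hvR : (fun a => f (x (τ a))) ∈ R i)

theorem main_free_baire {X : Type} [TopologicalSpace X] [PolishSpace X] [Nonempty X]
    (hX : Perfect (Set.univ : Set X))
    {ι : Type} [Countable ι] (n : ι → ℕ) (hn : ∀ i, 1 ≤ n i)
    (R : ∀ i, Set (Fin (n i) → X)) (hR : ∀ i, IsMeagre (R i)) :
    (∃ F : Set X, Dense F ∧ BaireSpace F ∧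
      ∀ i (x : Fin (n i) → X), Function.Injective x → (∀ k, x k ∈ F) → x ∉ R i) ∧
    ∀ κ : Cardinal, cofMeager ≤ κ → κ ≤ Cardinal.continuum →
      ∃ F : Set X, Dense F ∧ BaireSpace F ∧ Cardinal.mk F = κ ∧
        ∀ i (x : Fin (n i) → X), Function.Injective x → (∀ k, x k ∈ F) → x ∉ R i := by
  exact ⟨(exists_free_baire_mk_eq hX.acc n R hR cofMeager_le_continuum le_rfl).imp
    fun _ h => ⟨h.1, h.2.1, h.2.2.2⟩,
    fun _ hκ hκc => exists_free_baire_mk_eq hX.acc n R hR hκ hκc⟩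
end

section
/- Let X be a crowded Polish space and 𝓡 a collection of meager relations on X with |𝓡| < add(meager). Then there exists a nowhere meager subset F of X that is R-free for every R ∈ 𝓡. -/
/-- The additivity of the meager ideal on the Cantor space `2^ω`. -/
noncomputable def addMeager : Cardinal :=
  sInf { c | ∃ M : Set (Set (ℕ → Bool)), Cardinal.mk M = c ∧ (∀ s ∈ M, IsMeagre s) ∧
    ¬ IsMeagre (⋃₀ M) }

def NowhereMeager {X : Type*} [TopologicalSpace X] (S : Set X) : Prop :=
  ∀ U : Set X, IsOpen U → U.Nonempty → ¬ IsMeagre (S ∩ U)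

section

open Set Filter Topology Function

theorem IsMeagre.exists_seq_isOpen_dense {X : Type*} [TopologicalSpace X] {s : Set X}
    (hs : IsMeagre s) :
    ∃ O : ℕ → Set X, (∀ j, IsOpen (O j)) ∧ (∀ j, Dense (O j)) ∧ ⋂ j, O j ⊆ sᶜ := by
  obtain ⟨S, hopen, hdense, hcount, hsub⟩ := mem_residual_iff.1 hs
  obtain ⟨O, hO⟩ := (hcount.insert univ).exists_eq_range (insert_nonempty _ _)
  have hmem : ∀ j, O j ∈ insert univ S := fun j => hO ▸ mem_range_self j
  refine ⟨O, fun j => ?_, fun j => ?_, fun x hx => hsub fun t ht => ?_⟩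
  · rcases hmem j with h | h
    · simp [h]
    · exact hopen _ h
  · rcases hmem j with h | h
    · simp [h]
    · exact hdense _ h
  · obtain ⟨j, rfl⟩ : t ∈ range O := hO ▸ mem_insert_of_mem _ ht
    exact mem_iInter.1 hx j

/-- Neighbourhoods in a power of the Cantor space contain all points sharing a long enough
initial segment in every coordinate. -/
theorem exists_forall_agree_mem_of_mem_nhds {T : Type*} {z : T → ℕ → Bool}
    {D : Set (T → ℕ → Bool)} (hD : D ∈ 𝓝 z) :
    ∃ l, ∀ w : T → ℕ → Bool, (∀ τ, ∀ i < l, w τ i = z τ i) → w ∈ D := by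
  by_contra! h
  choose w hw hwD using h
  have hlim : Tendsto w atTop (𝓝 z) := by
    refine tendsto_pi_nhds.2 fun τ => tendsto_pi_nhds.2 fun i => ?_
    refine tendsto_const_nhds.congr' ?_
    filter_upwards [eventually_gt_atTop i] with l hl
    exact (hw l τ i hl).symm
  obtain ⟨l, hl⟩ := (hlim.eventually hD).exists
  exact hwD l hl

theorem isOpen_agree {T : Type*} [Finite T] (z : T → ℕ → Bool) (l : ℕ) :
    IsOpen {w : T → ℕ → Bool | ∀ τ, ∀ i < l, w τ i = z τ i} := by
  have : {w : T → ℕ → Bool | ∀ τ, ∀ i < l, w τ i = z τ i} =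
      ⋂ τ, ⋂ i : Fin l, {w | w τ i = z τ i} := by
    ext w
    simp only [mem_ofPred_eq, mem_iInter]
    exact ⟨fun h τ i => h τ i i.2, fun h τ i hi => h τ ⟨i, hi⟩⟩
  rw [this]
  refine isOpen_iInter_of_finite fun τ => isOpen_iInter_of_finite fun i => ?_
  have hcont : Continuous fun w : T → ℕ → Bool => w τ i := by fun_prop
  exact (isOpen_discrete {z τ i}).preimage hcont

theorem dense_preimage_comp_of_injective {S T X : Type*} [TopologicalSpace X] {σ : S → T}
    (hσ : Injective σ) {O : Set (S → X)} (hO : Dense O) :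
    Dense {z : T → X | z ∘ σ ∈ O} := by
  classical
  refine dense_iff_inter_open.2 fun V hV ⟨z, hz⟩ => ?_
  have hcont : Continuous fun y : S → X => extend σ y z := by
    refine continuous_pi fun τ => ?_
    by_cases h : ∃ s, σ s = τ
    · obtain ⟨s, rfl⟩ := h
      simpa only [hσ.extend_apply] using continuous_apply s
    · simpa only [extend_apply' _ _ _ h] using continuous_const
  have hmem : extend σ (z ∘ σ) z ∈ V := by
    convert hz
    ext1 τ
    by_cases h : ∃ s, σ s = τ
    · obtain ⟨s, rfl⟩ := h
      rw [hσ.extend_apply, comp_apply]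
    · rw [extend_apply' _ _ _ h]
  obtain ⟨y, hyV, hyO⟩ := hO.inter_open_nonempty _ (hV.preimage hcont) ⟨z ∘ σ, hmem⟩
  exact ⟨extend σ y z, hyV, by simpa only [mem_ofPred_eq, extend_comp hσ] using hyO⟩

/-- A finite stage of Mycielski's construction: every binary string of length `l` is extended so
that tuples of distinct strings are forced into finitely many given dense open sets. -/
theorem exists_extension_of_dense {O : ∀ m, ℕ → Set (Fin m → ℕ → Bool)}
    (hO : ∀ m j, IsOpen (O m j)) (hd : ∀ m j, Dense (O m j)) (l K : ℕ) :
    ∃ l' > l, ∃ e : (Fin l → Bool) → ℕ → Bool, (∀ σ (t : Fin l), e σ t = σ t) ∧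
      ∀ m < K, ∀ j < K, ∀ σ : Fin m → Fin l → Bool, Injective σ →
        ∀ x : Fin m → ℕ → Bool, (∀ a, ∀ i < l', x a i = e (σ a) i) → x ∈ O m j := by
  classical
  let I := (m : Fin K) × Fin K × {σ : Fin m → Fin l → Bool // Injective σ}
  let D : I → Set ((Fin l → Bool) → ℕ → Bool) := fun p => {z | z ∘ p.2.2.1 ∈ O p.1 p.2.1}
  have hDo : ∀ p, IsOpen (D p) := fun p =>
    (hO _ _).preimage (continuous_pi fun s => continuous_apply (p.2.2.1 s))
  have hDd : Dense (⋂ p, D p) :=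
    dense_iInter_of_isOpen hDo fun p => dense_preimage_comp_of_injective p.2.2.2 (hd _ _)
  let z₀ : (Fin l → Bool) → ℕ → Bool := fun σ i => if h : i < l then σ ⟨i, h⟩ else false
  obtain ⟨e, he, heD⟩ := hDd.inter_open_nonempty _ (isOpen_agree z₀ l) ⟨z₀, fun _ _ _ => rfl⟩
  obtain ⟨l', hl'⟩ := exists_forall_agree_mem_of_mem_nhds
    ((isOpen_iInter_of_finite hDo).mem_nhds heD)
  refine ⟨max l' (l + 1), by omega, e, fun σ t => by simpa [z₀] using he σ t t.2, ?_⟩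
  intro m hm j hj σ hσ x hx
  have hw := mem_iInter.1 (hl' (extend σ x e) fun τ i hi => ?_) ⟨⟨m, hm⟩, ⟨j, hj⟩, σ, hσ⟩
  · simpa only [D, mem_ofPred_eq, extend_comp hσ] using hw
  · by_cases h : ∃ a, σ a = τ
    · obtain ⟨a, rfl⟩ := h
      rw [hσ.extend_apply]
      exact hx a i (lt_max_of_lt_left hi)
    · rw [extend_apply' _ _ _ h]

/-- The point `x` follows, on the block `[L k, L (k + 1))`, the extension that `e k` prescribes for
its restriction to `L k`. -/
def FollowsAt (L : ℕ → ℕ) (e : ∀ k, (Fin (L k) → Bool) → ℕ → Bool) (x : ℕ → Bool) (k : ℕ) : Prop :=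
  ∀ i < L (k + 1), x i = e k (fun t => x t) i

section FollowsAt

variable {L : ℕ → ℕ} {e : ∀ k, (Fin (L k) → Bool) → ℕ → Bool}

theorem FollowsAt.congr (hL : StrictMono L) {x y : ℕ → Bool} {k : ℕ}
    (hx : FollowsAt L e x k) (h : ∀ i < L (k + 1), y i = x i) : FollowsAt L e y k := by
  intro i hi
  rw [h i hi, hx i hi]
  congr 1
  ext t
  exact (h t (t.2.trans (hL k.lt_succ_self))).symm

theorem isClosed_followsAt (k : ℕ) : IsClosed {x | FollowsAt L e x k} := by
  simp only [FollowsAt, ofPred_forall]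
  refine isClosed_iInter fun i => isClosed_iInter fun _ => ?_
  refine isClosed_eq (continuous_apply i) ?_
  have h : Continuous fun σ : Fin (L k) → Bool => e k σ i := continuous_of_discreteTopology
  exact h.comp (continuous_pi fun t : Fin (L k) => continuous_apply (t : ℕ))

theorem exists_followsAt (hL : StrictMono L) (he : ∀ k σ (t : Fin (L k)), e k σ t = σ t)
    (y : ℕ → Bool) (q : ℕ) :
    ∃ x, (∀ i < L q, x i = y i) ∧ ∀ k ≥ q, FollowsAt L e x k := by
  let w : ℕ → ℕ → Bool := fun t =>
    Nat.rec y (fun t v => e (q + t) fun s => v s) t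
  have hw : ∀ t i, i < L (q + t) → w (t + 1) i = w t i := fun t i hi => he (q + t) _ ⟨i, hi⟩
  have hstable : ∀ t s i, t ≤ s → i < L (q + t) → w s i = w t i := by
    intro t s i hts hi
    induction s, hts using Nat.le_induction with
    | base => rfl
    | succ s hts ih => rw [hw s i (hi.trans_le (hL.monotone (by omega))), ih]
  have hlim : ∀ t i, i < L (q + t) → w (i + 1) i = w t i := by
    intro t i hi
    have hi' : i < L (q + (i + 1)) := lt_of_lt_of_le (by omega) (hL.le_apply)
    rw [← hstable _ _ i (le_max_left t (i + 1)) hi, ← hstable _ _ i (le_max_right t (i + 1)) hi']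
  refine ⟨fun i => w (i + 1) i, fun i hi => hlim 0 i hi, fun k hk i hi => ?_⟩
  obtain ⟨t, rfl⟩ := Nat.exists_eq_add_of_le hk
  change w (i + 1) i = _
  rw [hlim (t + 1) i hi]
  change e (q + t) (fun s => w t s) i = _
  congr 1
  ext s
  exact (hlim t s s.2).symm

/-- The points following the prescribed extensions along an ultrafilter form a nowhere meager
set. -/
theorem nowhereMeager_followsAt (hL : StrictMono L)
    (he : ∀ k σ (t : Fin (L k)), e k σ t = σ t) {u : Ultrafilter ℕ} (hu : (u : Filter ℕ) ≤ atTop) :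
    NowhereMeager {x | ∀ᶠ k in (u : Filter ℕ), FollowsAt L e x k} := by
  rintro V hV ⟨z₀, hz₀⟩ hmeagre
  obtain ⟨O, hOo, hOd, hO⟩ := hmeagre.exists_seq_isOpen_dense
  have hVz : {z : Bool → ℕ → Bool | ∀ b, z b ∈ V} ∈ 𝓝 fun _ => z₀ := by
    have : IsOpen {z : Bool → ℕ → Bool | ∀ b, z b ∈ V} := by
      simp only [ofPred_forall]
      exact isOpen_iInter_of_finite fun b => hV.preimage (continuous_apply b)
    exact this.mem_nhds fun _ => hz₀
  obtain ⟨k₀, hk₀⟩ := exists_forall_agree_mem_of_mem_nhds hVz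
  let K : Set (Bool → ℕ → Bool) := {z | (∀ k ≥ k₀, FollowsAt L e (z false) k ∨
    FollowsAt L e (z true) k) ∧ ∀ b, ∀ i < k₀, z b i = z₀ i}
  have hK : IsClosed K := by
    refine IsClosed.inter (s₁ := {z | ∀ k ≥ k₀, _}) (s₂ := {z | ∀ b, ∀ i < k₀, _}) ?_ ?_
    · simp only [ofPred_forall]
      have hcl (b : Bool) (k : ℕ) : IsClosed {z : Bool → ℕ → Bool | FollowsAt L e (z b) k} :=
        (isClosed_followsAt k).preimage (continuous_apply (A := fun _ => ℕ → Bool) b)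
      exact isClosed_iInter fun k => isClosed_iInter fun _ => (hcl false k).union (hcl true k)
    · simp only [ofPred_forall]
      exact isClosed_iInter fun b => isClosed_iInter fun i => isClosed_iInter fun _ =>
        isClosed_eq (by fun_prop) continuous_const
  have : CompactSpace K := isCompact_iff_compactSpace.1 hK.isCompact
  have hKne : Nonempty K := by
    obtain ⟨x, hx, hxf⟩ := exists_followsAt hL he z₀ k₀
    exact ⟨⟨fun _ => x, fun k hk => Or.inl (hxf k hk),
      fun _ i hi => hx i (hi.trans_le (hL.le_apply))⟩⟩
  have hdense : ∀ p : Bool × ℕ, Dense {z : K | z.1 p.1 ∈ O p.2} := by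
    rintro ⟨a, j⟩
    refine dense_iff_inter_open.2 fun W hW ⟨z, hz⟩ => ?_
    obtain ⟨W', hW', rfl⟩ := isOpen_induced_iff.1 hW
    obtain ⟨l, hl⟩ := exists_forall_agree_mem_of_mem_nhds (hW'.mem_nhds hz)
    set q := max l k₀
    have hq : q ≤ L q := hL.le_apply
    obtain ⟨x, hxO, hx⟩ : ∃ x ∈ O j, ∀ i < L q, x i = z.1 a i := by
      obtain ⟨x, hx, hxO⟩ := (hOd j).inter_open_nonempty _
        ((isOpen_agree (T := Unit) (fun _ => z.1 a) (L q)).preimage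
          (continuous_pi fun _ => continuous_id)) ⟨z.1 a, fun _ _ _ => rfl⟩
      exact ⟨x, hxO, hx ()⟩
    obtain ⟨y, hy, hyf⟩ := exists_followsAt hL he (z.1 !a) q
    have hagree : ∀ b, ∀ i < L q, (if b = a then x else y) i = z.1 b i := by
      intro b i hi
      split_ifs with hb
      · rw [hb, hx i hi]
      · rw [hy i hi, Bool.eq_not_of_ne hb]
    refine ⟨⟨fun b => if b = a then x else y, fun k hk => ?_, fun b i hi => ?_⟩,
      hl _ fun b i hi => hagree b i (by omega), by simpa using hxO⟩
    · rcases lt_or_ge k q with hkq | hkq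
      · have hkL : L (k + 1) ≤ L q := hL.monotone hkq
        exact (z.2.1 k hk).imp
          (fun h => h.congr hL fun i hi => hagree _ i (hi.trans_le hkL))
          (fun h => h.congr hL fun i hi => hagree _ i (hi.trans_le hkL))
      · cases a
        · exact Or.inr (by simpa using hyf k hkq)
        · exact Or.inl (by simpa using hyf k hkq)
    · exact (hagree b i (by omega)).trans (z.2.2 b i hi)
  have hopen : ∀ p : Bool × ℕ, IsOpen {z : K | z.1 p.1 ∈ O p.2} := fun p =>
    (hOo p.2).preimage ((continuous_apply p.1).comp continuous_subtype_val)
  obtain ⟨z, hz⟩ := (dense_iInter_of_isOpen hopen hdense).nonempty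
  have hzO : ∀ b, z.1 b ∈ ⋂ j, O j := fun b => mem_iInter.2 fun j => mem_iInter.1 hz (b, j)
  have hzV : ∀ b, z.1 b ∈ V := hk₀ z.1 z.2.2
  have hor : ∀ᶠ k in (u : Filter ℕ), FollowsAt L e (z.1 false) k ∨ FollowsAt L e (z.1 true) k :=
    hu ((eventually_ge_atTop k₀).mono z.2.1)
  rcases Ultrafilter.eventually_or.1 hor with h | h
  · exact hO (hzO false) ⟨h, hzV false⟩
  · exact hO (hzO true) ⟨h, hzV true⟩

end FollowsAt

/-- Countably many meager relations on the Cantor space, one of each arity, have a common free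
nowhere meager set. -/
theorem exists_nowhereMeager_free_cantor (A : ∀ m, Set (Fin m → ℕ → Bool))
    (hA : ∀ m, IsMeagre (A m)) :
    ∃ F : Set (ℕ → Bool), NowhereMeager F ∧
      ∀ m (x : Fin m → ℕ → Bool), Injective x → (∀ a, x a ∈ F) → x ∉ A m := by
  choose O hOo hOd hO using fun m => (hA m).exists_seq_isOpen_dense
  choose l' hl' e he hforce using exists_extension_of_dense hOo hOd
  obtain ⟨L, hLsucc⟩ : ∃ L : ℕ → ℕ, ∀ k, L (k + 1) = l' (L k) k :=
    ⟨fun k => Nat.rec 0 (fun k l => l' l k) k, fun _ => rfl⟩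
  have hL : StrictMono L := strictMono_nat_of_lt_succ fun k => hLsucc k ▸ hl' (L k) k
  let e' : ∀ k, (Fin (L k) → Bool) → ℕ → Bool := fun k => e (L k) k
  let u : Ultrafilter ℕ := hyperfilter ℕ
  have hu : (u : Filter ℕ) ≤ atTop := Nat.hyperfilter_le_atTop
  refine ⟨_, nowhereMeager_followsAt (e := e') hL (fun k => he (L k) k) hu, fun m x hx hF => ?_⟩
  refine hO m (mem_iInter.2 fun j => ?_)
  have hsep : ∀ᶠ k in atTop, Injective fun (a : Fin m) (t : Fin (L k)) => x a t := by
    have : ∀ a b : Fin m, a ≠ b → ∀ᶠ k in atTop, ∃ t : Fin (L k), x a t ≠ x b t := by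
      intro a b hab
      obtain ⟨i, hi⟩ := ne_iff.1 (hx.ne hab)
      filter_upwards [eventually_gt_atTop i] with k hk
      exact ⟨⟨i, hk.trans_le (hL.le_apply)⟩, hi⟩
    have hall : ∀ᶠ k in atTop, ∀ a b : Fin m, a ≠ b → ∃ t : Fin (L k), x a t ≠ x b t := by
      simpa only [eventually_all] using this
    filter_upwards [hall] with k hk a b hab
    by_contra hne
    obtain ⟨t, ht⟩ := hk a b hne
    exact ht (congrFun hab t)
  obtain ⟨k, hFk, hsepk, hmk, hjk⟩ := ((eventually_all.2 hF).and ((hsep.filter_mono hu).and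
    (((eventually_gt_atTop m).filter_mono hu).and ((eventually_gt_atTop j).filter_mono hu)))).exists
  exact hforce (L k) k m hmk j hjk _ hsepk x fun a i hi => hFk a i (hLsucc k ▸ hi)

end

section

open Set Filter Topology Function PiNat

theorem Topology.IsInducing.isMeagre_preimage {X Y : Type*} [TopologicalSpace X]
    [TopologicalSpace Y] {f : X → Y} (hf : IsInducing f) (hd : DenseRange f) {s : Set Y}
    (hs : IsMeagre s) : IsMeagre (f ⁻¹' s) := by
  have : Tendsto f (residual X) (residual Y) := by
    refine le_countableGenerate_iff_of_countableInterFilter.mpr ?_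
    rintro t ⟨ht, htd⟩
    refine residual_of_dense_open (ht.preimage hf.continuous) ?_
    refine dense_iff_inter_open.2 fun V hV hVne => ?_
    obtain ⟨W, hW, rfl⟩ := hf.isOpen_iff.1 hV
    obtain ⟨z, hz⟩ := hVne
    obtain ⟨x, hxW, hxt⟩ := hd.exists_mem_open (hW.inter ht)
      (htd.inter_open_nonempty W hW ⟨f z, hz⟩)
    exact ⟨x, hxW, hxt⟩
  exact this hs

/-- A nonempty open subset of a separable metric space without isolated points is, up to a nowhere
dense set, the disjoint union of infinitely many small open sets with closures inside it. -/
theorem exists_disjoint_open_seq {Y : Type*} [MetricSpace Y] [TopologicalSpace.SeparableSpace Y]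
    [∀ x : Y, (𝓝[≠] x).NeBot] {U : Set Y} (hU : IsOpen U) (hne : U.Nonempty) {ε : ℝ} (hε : 0 < ε) :
    ∃ V : ℕ → Set Y, (∀ a, IsOpen (V a) ∧ (V a).Nonempty ∧ closure (V a) ⊆ U ∧
      ∀ x ∈ V a, ∀ y ∈ V a, dist x y ≤ ε) ∧ Pairwise (Disjoint on V) ∧ U ⊆ closure (⋃ a, V a) := by
  obtain ⟨p, hp⟩ := hne
  let S : Set (Set (Set Y)) := {c | (∀ v ∈ c, IsOpen v ∧ v.Nonempty ∧ closure v ⊆ U \ {p} ∧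
    ∀ x ∈ v, ∀ y ∈ v, dist x y ≤ ε) ∧ c.PairwiseDisjoint id}
  obtain ⟨m, hm⟩ : ∃ m, Maximal (· ∈ S) m := by
    refine zorn_subset S fun c hc hchain => ⟨⋃₀ c, ⟨?_, ?_⟩, fun s hs => subset_sUnion_of_mem hs⟩
    · rintro v ⟨s, hs, hv⟩
      exact (hc hs).1 v hv
    · exact (pairwiseDisjoint_sUnion hchain.directedOn).2 fun s hs => (hc hs).2
  have hmeet : ∀ W, IsOpen W → W.Nonempty → W ⊆ U → (W ∩ ⋃₀ m).Nonempty := by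
    intro W hW hWne hWU
    by_contra hempty
    obtain ⟨q, hqW, hqp⟩ : (W \ {p}).Nonempty := by
      obtain ⟨w, hw⟩ := hWne
      by_cases hwp : w = p
      · subst hwp
        have h : W ∩ {w}ᶜ ∈ 𝓝[≠] w :=
          inter_mem (mem_nhdsWithin_of_mem_nhds (hW.mem_nhds hw)) self_mem_nhdsWithin
        exact Filter.nonempty_of_mem h
      · exact ⟨w, hw, hwp⟩
    obtain ⟨r, hr, hrW⟩ := Metric.nhds_basis_closedBall.mem_iff.1
      ((hW.sdiff isClosed_singleton).mem_nhds ⟨hqW, hqp⟩)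
    let v := Metric.ball q (min r (ε / 2))
    have hqv : q ∈ v := Metric.mem_ball_self (by positivity)
    have hvW : closure v ⊆ W \ {p} := Metric.closure_ball_subset_closedBall.trans
      ((Metric.closedBall_subset_closedBall (min_le_left _ _)).trans hrW)
    have hvm : insert v m ∈ S := by
      refine ⟨?_, ?_⟩
      · rintro w (rfl | hw)
        · refine ⟨Metric.isOpen_ball, ⟨q, hqv⟩, hvW.trans (sdiff_subset_sdiff_left hWU), ?_⟩
          intro x hx y hy
          have hx' := (Metric.mem_ball.1 hx).trans_le (min_le_right _ _)
          have hy' := (Metric.mem_ball'.1 hy).trans_le (min_le_right _ _)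
          linarith [dist_triangle x q y]
        · exact hm.prop.1 w hw
      · refine hm.prop.2.insert fun w hw _ => disjoint_left.2 fun x hxv hxw => hempty ?_
        exact ⟨x, (hvW (subset_closure hxv)).1, w, hw, hxw⟩
    exact hempty ⟨q, hqW, v, hm.le_of_ge hvm (subset_insert _ _) (mem_insert _ _), hqv⟩
  have hinf : m.Infinite := by
    intro hfin
    obtain ⟨x, ⟨-, hx⟩, v, hv, hxv⟩ := hmeet (U \ ⋃ v ∈ m, closure v)
      (hU.sdiff (hfin.isClosed_biUnion fun _ _ => isClosed_closure))
      ⟨p, hp, by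
        simp only [mem_iUnion, not_exists]
        exact fun v hv hpv => ((hm.prop.1 v hv).2.2.1 hpv).2 rfl⟩ sdiff_subset
    exact hx (mem_biUnion hv (subset_closure hxv))
  have hcount : m.Countable := hm.prop.2.countable_of_isOpen (fun v hv => (hm.prop.1 v hv).1)
    fun v hv => (hm.prop.1 v hv).2.1
  have := hinf.to_subtype
  have := hcount.to_subtype
  obtain ⟨_⟩ := nonempty_denumerable m
  let φ : ℕ ≃ m := (Denumerable.eqv m).symm
  refine ⟨fun a => φ a, fun a => ?_, fun a b hab => ?_, fun x hx => ?_⟩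
  · obtain ⟨h1, h2, h3, h4⟩ := hm.prop.1 _ (φ a).2
    exact ⟨h1, h2, h3.trans sdiff_subset, h4⟩
  · exact hm.prop.2 (φ a).2 (φ b).2 fun h => hab (φ.injective (Subtype.ext h))
  · refine mem_closure_iff.2 fun W hW hxW => ?_
    obtain ⟨y, ⟨hyW, -⟩, v, hv, hyv⟩ := hmeet (W ∩ U) (hW.inter hU) ⟨x, hxW, hx⟩ inter_subset_right
    exact ⟨y, hyW, mem_iUnion.2 ⟨φ.symm ⟨v, hv⟩, by simpa using hyv⟩⟩

/-- A nonempty Polish space without isolated points contains a comeager copy of the Baire space. -/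
theorem exists_isInducing_range_mem_residual (Y : Type*) [TopologicalSpace Y] [PolishSpace Y]
    [Nonempty Y] [∀ x : Y, (𝓝[≠] x).NeBot] :
    ∃ f : (ℕ → ℕ) → Y, IsInducing f ∧ range f ∈ residual Y := by
  let := TopologicalSpace.upgradeIsCompletelyMetrizable Y
  choose V hV hVdisj hVdense using fun (U : {U : Set Y // IsOpen U ∧ U.Nonempty}) (n : ℕ) =>
    exists_disjoint_open_seq U.2.1 U.2.2 (ε := (1 / 2) ^ n) (by positivity)
  let B : List ℕ → {U : Set Y // IsOpen U ∧ U.Nonempty} := fun l =>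
    List.rec ⟨univ, isOpen_univ, univ_nonempty⟩
      (fun a l U => ⟨V U l.length a, (hV U l.length a).1, (hV U l.length a).2.1⟩) l
  let A : List ℕ → Set Y := fun l => (B l).1
  have hA (l : List ℕ) (a : ℕ) : A (a :: l) = V (B l) l.length a := rfl
  have hopen (l : List ℕ) : IsOpen (A l) := (B l).2.1
  have hclos : CantorScheme.ClosureAntitone A := fun l a => (hV (B l) l.length a).2.2.1
  have hdisj : CantorScheme.Disjoint A := fun l a b hab => hVdisj (B l) l.length hab
  have hdiam : CantorScheme.VanishingDiam A := by
    intro x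
    rw [← tendsto_add_atTop_iff_nat 1]
    have hlim : Tendsto (fun n : ℕ => ENNReal.ofReal ((1 / 2) ^ n)) atTop (𝓝 0) := by
      simpa using ENNReal.tendsto_ofReal
        (tendsto_pow_atTop_nhds_zero_of_lt_one (r := (1 / 2 : ℝ)) (by norm_num) (by norm_num))
    refine tendsto_of_tendsto_of_tendsto_of_le_of_le tendsto_const_nhds hlim
      (fun _ => zero_le) fun n => Metric.ediam_le fun y hy z hz => ?_
    rw [edist_dist]
    have := (hV (B (res x n)) (res x n).length (x n)).2.2.2 y hy z hz
    rw [res_length] at this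
    exact ENNReal.ofReal_le_ofReal this
  have hunique : ∀ (l l' : List ℕ), l.length = l'.length → ∀ y ∈ A l, y ∈ A l' → l = l' := by
    intro l
    induction l with
    | nil => intro l' hl; simp_all [eq_comm]
    | cons a l ih =>
      rintro (_ | ⟨b, l'⟩) hl y hy hy'
      · simp at hl
      · obtain rfl := ih l' (by simpa using hl) y (hclos.antitone l a hy) (hclos.antitone l' b hy')
        by_contra hne
        have hab : Disjoint (A (a :: l)) (A (b :: l)) := hdisj l (by simpa using hne)
        exact disjoint_left.1 hab hy hy'
  have hdom := hclos.map_of_vanishingDiam hdiam fun l => (B l).2.2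
  let f : (ℕ → ℕ) → Y := fun x => (CantorScheme.inducedMap A).2 ⟨x, hdom ▸ mem_univ x⟩
  have hf (x : ℕ → ℕ) (n : ℕ) : f x ∈ A (res x n) := CantorScheme.map_mem _ n
  have hfc : Continuous f := hdiam.map_continuous.comp (continuous_id.subtype_mk _)
  refine ⟨f, isInducing_iff_nhds.2 fun x => le_antisymm (hfc.tendsto x).le_comap ?_, ?_⟩
  · intro N hN
    obtain ⟨_, ⟨y, n, rfl⟩, hxy, hyN⟩ :=
      (isTopologicalBasis_cylinders fun _ => ℕ).mem_nhds_iff.1 hN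
    refine ⟨A (res x n), (hopen _).mem_nhds (hf x n), fun z hz => hyN ?_⟩
    rw [← mem_cylinder_iff_eq.1 hxy, cylinder_eq_res]
    exact hunique _ _ (by simp) _ (hf z n) hz
  let W : ℕ → Set Y := fun n => ⋃ l : {l : List ℕ // l.length = n}, A l
  have hW : ∀ n, Dense (W n) := by
    intro n
    induction n with
    | zero =>
      have : W 0 = univ := eq_univ_of_forall fun y => mem_iUnion.2 ⟨⟨[], rfl⟩, mem_univ y⟩
      simp [this]
    | succ n ih =>
      have hsub : W n ⊆ closure (W (n + 1)) := iUnion_subset fun l =>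
        (hVdense (B l.1) l.1.length).trans (closure_mono (iUnion_subset fun a =>
          subset_iUnion (fun l : {l : List ℕ // l.length = n + 1} => A l)
            ⟨a :: l.1, by simp [l.2]⟩))
      exact dense_closure.1 (ih.mono hsub)
  refine mem_of_superset (countable_iInter_mem.2 fun n =>
    residual_of_dense_open (isOpen_iUnion fun _ => hopen _) (hW n)) fun y hy => ?_
  have hs : ∀ n, ∃ l : List ℕ, l.length = n ∧ y ∈ A l := fun n => by
    obtain ⟨l, hl⟩ := mem_iUnion.1 (mem_iInter.1 hy n)
    exact ⟨l, l.2, hl⟩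
  choose s hslen hs using hs
  have hsucc : ∀ n, ∃ a, s (n + 1) = a :: s n := by
    intro n
    obtain ⟨a, l, hal⟩ := List.exists_cons_of_length_eq_add_one (hslen (n + 1))
    have hlen := hslen (n + 1)
    have hmem := hs (n + 1)
    rw [hal] at hlen hmem
    refine ⟨a, hal.trans ?_⟩
    rw [hunique l (s n) (by rw [hslen]; simpa using hlen) y (hclos.antitone l a hmem) (hs n)]
  choose x hx using hsucc
  have hres : ∀ n, res x n = s n := by
    intro n
    induction n with
    | zero => exact (List.eq_nil_of_length_eq_zero (hslen 0)).symm
    | succ n ih => rw [res_succ, ih, hx]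
  refine ⟨x, eq_of_forall_dist_le fun ε hε => ?_⟩
  obtain ⟨n, hn⟩ := hdiam.dist_lt ε hε x
  exact (hn _ (hf x n) y (hres n ▸ hs n)).le

instance polishSpace_cantor : PolishSpace (ℕ → Bool) := by
  have : TopologicalSpace.IsCompletelyMetrizableSpace (ℕ → Bool) :=
    let := TopologicalSpace.metrizableSpaceMetric (ℕ → Bool)
    inferInstance
  infer_instance

instance neBot_nhdsNE_cantor (x : ℕ → Bool) : (𝓝[≠] x).NeBot := by
  have hlim : Tendsto (fun n => update x n (!x n)) atTop (𝓝 x) := by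
    refine tendsto_pi_nhds.2 fun i => tendsto_const_nhds.congr' ?_
    filter_upwards [eventually_gt_atTop i] with n hn
    rw [update_of_ne hn.ne]
  exact (tendsto_nhdsWithin_iff.2 ⟨hlim, Eventually.of_forall fun n => by simp⟩).neBot

theorem isMeagre_iUnion_of_lt_addMeager {ι : Type} (hι : Cardinal.mk ι < addMeager)
    {B : ι → Set (ℕ → Bool)} (hB : ∀ i, IsMeagre (B i)) : IsMeagre (⋃ i, B i) := by
  by_contra h
  refine notMem_of_lt_csInf (Cardinal.mk_range_le.trans_lt hι) (OrderBot.bddBelow _)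
    ⟨range B, rfl, forall_mem_range.2 hB, by rwa [sUnion_range]⟩

theorem isMeagre_iUnion_pi_of_lt_addMeager {ι : Type} (hι : Cardinal.mk ι < addMeager) {m : ℕ}
    (hm : 1 ≤ m) {B : ι → Set (Fin m → ℕ → Bool)} (hB : ∀ i, IsMeagre (B i)) :
    IsMeagre (⋃ i, B i) := by
  have : Nonempty (Fin m) := ⟨⟨0, hm⟩⟩
  obtain ⟨_⟩ := nonempty_denumerable (Fin m × ℕ)
  let h : (Fin m → ℕ → Bool) ≃ₜ (ℕ → Bool) :=
    (Homeomorph.piCurry (Z := Bool)).symm.trans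
      (Homeomorph.piCongrLeft (Y := fun _ => Bool) (Denumerable.eqv (Fin m × ℕ)))
  have := isMeagre_iUnion_of_lt_addMeager hι fun i => h.isInducing.isMeagre_image (hB i)
  rw [← image_iUnion] at this
  simpa [h.injective.preimage_image] using
    this.preimage_of_isOpenMap h.continuous h.isOpenMap

/-- A nowhere meager set can be transported along comeager copies of a common space. -/
theorem NowhereMeager.image_preimage {X Y Z : Type*} [TopologicalSpace X] [TopologicalSpace Y]
    [TopologicalSpace Z] {f : Z → X} {g : Z → Y} (hf : IsInducing f) (hfd : DenseRange f)
    (hg : IsInducing g) (hgr : range g ∈ residual Y) {F : Set Y} (hF : NowhereMeager F) :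
    NowhereMeager (f '' (g ⁻¹' F)) := by
  intro U hU hUne hmeagre
  obtain ⟨V, hV, hVU⟩ := hg.isOpen_iff.1 (hU.preimage hf.continuous)
  obtain ⟨z, hz⟩ := hfd.exists_mem_open hU hUne
  refine hF V hV ⟨g z, by rwa [← mem_preimage, hVU]⟩ (IsMeagre.mono ?_
    ((hg.isMeagre_image (hf.isMeagre_preimage hfd hmeagre)).union
      (show IsMeagre (range g)ᶜ by rwa [IsMeagre, compl_compl])))
  rintro y ⟨hyF, hyV⟩
  by_cases hy : y ∈ range g
  · obtain ⟨w, rfl⟩ := hy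
    have hw : w ∈ f ⁻¹' U := hVU ▸ hyV
    exact Or.inl ⟨w, ⟨⟨w, hyF, rfl⟩, hw⟩, rfl⟩
  · exact Or.inr hy

end

theorem free_nowhere_meager_of_lt_add {X : Type} [TopologicalSpace X] [PolishSpace X]
    [Nonempty X] (hX : Perfect (Set.univ : Set X))
    {ι : Type} (hι : Cardinal.mk ι < addMeager) (n : ι → ℕ) (hn : ∀ i, 1 ≤ n i)
    (R : ∀ i, Set (Fin (n i) → X)) (hR : ∀ i, IsMeagre (R i)) :
    ∃ F : Set X, NowhereMeager F ∧
      ∀ i (x : Fin (n i) → X), Function.Injective x → (∀ k, x k ∈ F) → x ∉ R i := by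
  have hne (x : X) : (nhdsWithin x {x}ᶜ).NeBot := by
    simpa [AccPt] using hX.acc x (Set.mem_univ x)
  obtain ⟨f, hf, hfr⟩ := exists_isInducing_range_mem_residual X
  obtain ⟨g, hg, hgr⟩ := exists_isInducing_range_mem_residual (ℕ → Bool)
  have hfd : DenseRange f := dense_of_mem_residual hfr
  let R' : ∀ i, Set (Fin (n i) → ℕ → Bool) := fun i =>
    (Pi.map fun _ => g) '' ((Pi.map fun _ => f) ⁻¹' R i)
  have hR' (i : ι) : IsMeagre (R' i) :=
    (Topology.IsInducing.piMap fun _ => hg).isMeagre_image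
      ((Topology.IsInducing.piMap fun _ => hf).isMeagre_preimage (DenseRange.piMap fun _ => hfd)
        (hR i))
  obtain ⟨F, hF, hfree⟩ := exists_nowhereMeager_free_cantor
    (fun m => ⋃ i, {x | ∃ h : n i = m, (fun k => x (Fin.cast h k)) ∈ R' i}) fun m => by
      rcases Nat.eq_zero_or_pos m with rfl | hm
      · convert IsMeagre.empty
        refine Set.iUnion_eq_empty.2 fun i => Set.eq_empty_of_forall_notMem ?_
        rintro x ⟨h, -⟩
        exact absurd (hn i) (by omega)
      · refine isMeagre_iUnion_pi_of_lt_addMeager hι hm fun i => ?_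
        by_cases h : n i = m
        · subst h
          exact (hR' i).mono (by rintro x ⟨_, hx⟩; exact hx)
        · simpa [h] using IsMeagre.empty
  refine ⟨f '' (g ⁻¹' F), hF.image_preimage hf hfd hg hgr, fun i x hx hxF hxR => ?_⟩
  choose z hzF hz using hxF
  obtain rfl : (fun k => f (z k)) = x := funext hz
  refine hfree (n i) (fun k => g (z k)) (hg.injective.comp (Function.Injective.of_comp hx)) hzF ?_
  exact Set.mem_iUnion.2 ⟨i, rfl, z, hxR, rfl⟩
end

section
/- Assume 𝔡 = 𝔠 and Martin's Axiom for countable posets (equivalently cov(meager) = 𝔠). Let X be a crowded Polish space and 𝓡 a collection of meager relations on X with |𝓡| < 𝔠. Then there exists F ⊆ X such that F is dense in X, F is completely Baire (every closed subspace of F is a Baire space), and F is R-free for every R ∈ 𝓡. -/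
/-- The dominating number `𝔡`. -/
noncomputable def dNumber : Cardinal :=
  sInf { c | ∃ D : Set (ℕ → ℕ), Cardinal.mk D = c ∧
    ∀ g : ℕ → ℕ, ∃ f ∈ D, ∀ᶠ m in Filter.atTop, g m ≤ f m }

/-- The covering number of the meager ideal on the Cantor space `2^ω`. -/
noncomputable def covMeager : Cardinal :=
  sInf { c | ∃ M : Set (Set (ℕ → Bool)), Cardinal.mk M = c ∧ (∀ s ∈ M, IsMeagre s) ∧
    ⋃₀ M = Set.univ }

open Set Filter Topology Cardinal

namespace CompletelyBaireFree

/-! ### Transferring the covering number of category from Cantor space to Polish spaces -/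

theorem exists_forall_notMem_of_lt_covMeager {J : Type} (hJ : #J < covMeager)
    (N : J → Set (ℕ → Bool)) (hN : ∀ j, IsNowhereDense (N j)) : ∃ x, ∀ j, x ∉ N j := by
  by_contra! h
  have hle : covMeager ≤ #(range N) := by
    refine csInf_le' ⟨range N, rfl, ?_, ?_⟩
    · rintro _ ⟨j, rfl⟩
      exact (hN j).isMeagre
    · refine eq_univ_of_forall fun x => ?_
      obtain ⟨j, hj⟩ := h x
      exact ⟨N j, ⟨j, rfl⟩, hj⟩
  exact absurd hJ (not_lt.2 (hle.trans mk_range_le))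

/-- Decode a binary sequence, read as a matrix via `Nat.pair`, into the sequence of positions of
the first `true` in each row. -/
noncomputable def firstTrue (x : ℕ → Bool) (k : ℕ) : ℕ :=
  sInf {j | x (Nat.pair k j) = true}

theorem firstTrue_eq {x : ℕ → Bool} {k a : ℕ} (ha : x (Nat.pair k a) = true)
    (hlt : ∀ j < a, x (Nat.pair k j) = false) : firstTrue x k = a := by
  refine le_antisymm (Nat.sInf_le ha) (le_csInf ⟨a, ha⟩ fun j hj => ?_)
  by_contra! hja
  simp [hlt j hja] at hj

theorem eventually_firstTrue_eq {x : ℕ → Bool} {k : ℕ} (h : ∃ j, x (Nat.pair k j) = true) :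
    ∀ᶠ y in 𝓝 x, firstTrue y k = firstTrue x k := by
  have hmem : x (Nat.pair k (firstTrue x k)) = true := Nat.sInf_mem h
  have hev : ∀ᶠ y in 𝓝 x, ∀ j ∈ Iic (firstTrue x k), y (Nat.pair k j) = x (Nat.pair k j) := by
    rw [Filter.eventually_all_finite (finite_Iic _)]
    intro j _
    exact (continuous_apply (Nat.pair k j)).continuousAt.eventually_mem
      ((isOpen_discrete {x (Nat.pair k j)}).mem_nhds rfl)
  filter_upwards [hev] with y hy
  refine firstTrue_eq ((hy _ self_mem_Iic).trans hmem) fun j hj => ?_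
  rw [hy j hj.le]
  simpa using Nat.notMem_of_lt_sInf hj

section Decode

variable {P : Type} [MetricSpace P]

open Classical in
/-- One step of the nested sequence of balls `ball p (1/2)^l`: move to the ball coded by `a` if it
lies well inside the current one, and otherwise halve the radius. -/
noncomputable def nextBall (d : ℕ → P) (s : P × ℕ) (a : ℕ) : P × ℕ :=
  if Metric.closedBall (d a.unpair.1) ((1 / 2 : ℝ) ^ a.unpair.2) ⊆ Metric.ball s.1 ((1 / 2) ^ s.2) ∧
    s.2 < a.unpair.2 then (d a.unpair.1, a.unpair.2) else (s.1, s.2 + 1)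

noncomputable def ballSeq (d : ℕ → P) (y : ℕ → ℕ) : ℕ → P × ℕ
  | 0 => (d 0, 0)
  | k + 1 => nextBall d (ballSeq d y k) (y k)

theorem closedBall_nextBall_subset (d : ℕ → P) (s : P × ℕ) (a : ℕ) :
    Metric.closedBall (nextBall d s a).1 ((1 / 2 : ℝ) ^ (nextBall d s a).2) ⊆
      Metric.ball s.1 ((1 / 2) ^ s.2) := by
  unfold nextBall
  split_ifs with h
  · exact h.1
  · apply Metric.closedBall_subset_ball
    simp only [pow_succ]
    have : (0 : ℝ) < (1 / 2) ^ s.2 := by positivity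
    linarith

theorem lt_nextBall_snd (d : ℕ → P) (s : P × ℕ) (a : ℕ) : s.2 < (nextBall d s a).2 := by
  unfold nextBall
  split_ifs with h
  · exact h.2
  · exact Nat.lt_succ_self _

theorem le_ballSeq_snd (d : ℕ → P) (y : ℕ → ℕ) (k : ℕ) : k ≤ (ballSeq d y k).2 := by
  induction k with
  | zero => exact Nat.zero_le _
  | succ k ih => exact ih.trans_lt (lt_nextBall_snd d (ballSeq d y k) (y k))

theorem ballSeq_congr (d : ℕ → P) {y z : ℕ → ℕ} {k : ℕ} (h : ∀ i < k, y i = z i) :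
    ballSeq d y k = ballSeq d z k := by
  induction k with
  | zero => rfl
  | succ k ih =>
    simp only [ballSeq]
    rw [ih fun i hi => h i (hi.trans k.lt_succ_self), h k k.lt_succ_self]

theorem antitone_closedBall_ballSeq (d : ℕ → P) (y : ℕ → ℕ) :
    Antitone fun k => Metric.closedBall (ballSeq d y k).1 ((1 / 2 : ℝ) ^ (ballSeq d y k).2) :=
  antitone_nat_of_succ_le fun k =>
    (closedBall_nextBall_subset d (ballSeq d y k) (y k)).trans Metric.ball_subset_closedBall

theorem exists_mem_closedBall_ballSeq [CompleteSpace P] (d : ℕ → P) (y : ℕ → ℕ) :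
    ∃ p, ∀ k, p ∈ Metric.closedBall (ballSeq d y k).1 ((1 / 2 : ℝ) ^ (ballSeq d y k).2) := by
  have hmem : ∀ k m, k ≤ m → (ballSeq d y m).1 ∈
      Metric.closedBall (ballSeq d y k).1 ((1 / 2 : ℝ) ^ (ballSeq d y k).2) := fun k m hkm =>
    antitone_closedBall_ballSeq d y hkm (Metric.mem_closedBall_self (by positivity))
  have hcauchy : CauchySeq fun k => (ballSeq d y k).1 := by
    refine cauchySeq_of_le_geometric (1 / 2 : ℝ) 1 (by norm_num) fun k => ?_
    rw [dist_comm, one_mul]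
    exact (Metric.mem_closedBall.1 (hmem k (k + 1) k.le_succ)).trans
      (pow_le_pow_of_le_one (by norm_num) (by norm_num) (le_ballSeq_snd d y k))
  obtain ⟨p, hp⟩ := cauchySeq_tendsto_of_complete hcauchy
  exact ⟨p, fun k => Metric.isClosed_closedBall.mem_of_tendsto hp
    (eventually_atTop.2 ⟨k, fun m hm => hmem k m hm⟩)⟩

theorem exists_nextBall_subset {d : ℕ → P} (hd : DenseRange d) (s : P × ℕ) {V : Set P}
    (hV : IsOpen V) (hne : (V ∩ Metric.ball s.1 ((1 / 2) ^ s.2)).Nonempty) :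
    ∃ a, Metric.closedBall (nextBall d s a).1 ((1 / 2 : ℝ) ^ (nextBall d s a).2) ⊆ V := by
  obtain ⟨v, hv⟩ := hne
  obtain ⟨ε, hε, hball⟩ := Metric.isOpen_iff.1 (hV.inter Metric.isOpen_ball) v hv
  obtain ⟨l₀, hl₀⟩ := exists_pow_lt_of_lt_one (half_pos hε) (by norm_num : (1 / 2 : ℝ) < 1)
  set l := max l₀ (s.2 + 1)
  have hl : (1 / 2 : ℝ) ^ l < ε / 2 :=
    (pow_le_pow_of_le_one (by norm_num) (by norm_num) (le_max_left _ _)).trans_lt hl₀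
  obtain ⟨m, hm⟩ := hd.exists_dist_lt v (half_pos hε)
  have hsub : Metric.closedBall (d m) ((1 / 2 : ℝ) ^ l) ⊆ V ∩ Metric.ball s.1 ((1 / 2) ^ s.2) := by
    refine (Metric.closedBall_subset_ball' ?_).trans hball
    rw [dist_comm]
    linarith
  have hlt : s.2 < l := lt_of_lt_of_le s.2.lt_succ_self (le_max_right _ _)
  refine ⟨Nat.pair m l, ?_⟩
  rw [nextBall, Nat.unpair_pair, if_pos ⟨hsub.trans inter_subset_right, hlt⟩]
  exact hsub.trans inter_subset_left

/-- A nowhere dense set pulls back to a nowhere dense subset of Cantor space along any map picking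
a point of the nested balls coded by a binary sequence. -/
theorem isNowhereDense_preimage_of_mem_ballSeq {d : ℕ → P} (hd : DenseRange d)
    {f : (ℕ → Bool) → P}
    (hf : ∀ x k, f x ∈ Metric.closedBall (ballSeq d (firstTrue x) k).1
      ((1 / 2 : ℝ) ^ (ballSeq d (firstTrue x) k).2))
    {N : Set P} (hN : IsNowhereDense N) : IsNowhereDense (f ⁻¹' N) := by
  classical
  by_contra hcon
  obtain ⟨x, hx⟩ := nonempty_iff_ne_empty.2 hcon
  obtain ⟨K, hK⟩ : ∃ K, PiNat.cylinder x K ⊆ closure (f ⁻¹' N) := by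
    obtain ⟨_, ⟨z, K, rfl⟩, hxz, hsub⟩ := (PiNat.isTopologicalBasis_cylinders
      (fun _ : ℕ => Bool)).exists_subset_of_mem_open hx isOpen_interior
    rw [PiNat.mem_cylinder_iff_eq.1 hxz |>.symm] at hsub
    exact ⟨K, hsub.trans interior_subset⟩
  let x₀ : ℕ → Bool := fun i => if i < K then x i else true
  let s := ballSeq d (firstTrue x₀) K
  obtain ⟨a, ha⟩ : ∃ a, Metric.closedBall (nextBall d s a).1 ((1 / 2 : ℝ) ^ (nextBall d s a).2) ⊆
      (closure N)ᶜ := by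
    refine exists_nextBall_subset hd s isClosed_closure.isOpen_compl ?_
    by_contra hemp
    have hsub : Metric.ball s.1 ((1 / 2 : ℝ) ^ s.2) ⊆ interior (closure N) := by
      refine interior_maximal (fun z hz => ?_) Metric.isOpen_ball
      by_contra hzN
      exact hemp ⟨z, hzN, hz⟩
    rw [hN] at hsub
    exact hsub (Metric.mem_ball_self (by positivity))
  let x₁ : ℕ → Bool := fun i =>
    if i < K then x i else if i.unpair.1 = K then decide (i.unpair.2 = a) else true
  have hge : ∀ k j, K ≤ k → ¬ Nat.pair k j < K := fun k j hk =>
    not_lt.2 (hk.trans (Nat.left_le_pair k j))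
  have hrow : ∀ k < K, firstTrue x₁ k = firstTrue x₀ k := by
    intro k hk
    have : ∀ j, x₁ (Nat.pair k j) = x₀ (Nat.pair k j) := fun j => by
      simp [x₁, x₀, hk.ne]
    simp [firstTrue, this]
  have hlast : firstTrue x₁ K = a :=
    firstTrue_eq (by simp [x₁, hge K a le_rfl]) fun j hj => by simp [x₁, hge K j le_rfl, hj.ne]
  have hex : ∀ k ≤ K, ∃ j, x₁ (Nat.pair k j) = true := by
    intro k hk
    rcases hk.lt_or_eq with hk | rfl
    · exact ⟨K, by simp [x₁, hk.ne, not_lt.2 (Nat.right_le_pair k K)]⟩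
    · exact ⟨a, by simp [x₁, hge k a le_rfl]⟩
  have hev : ∀ᶠ z in 𝓝 x₁, ∀ k ∈ Iic K, firstTrue z k = firstTrue x₁ k := by
    rw [Filter.eventually_all_finite (finite_Iic _)]
    exact fun k hk => eventually_firstTrue_eq (hex k hk)
  have hx₁ : x₁ ∈ closure (f ⁻¹' N) := hK fun i hi => by simp [x₁, hi]
  obtain ⟨z, hz, hzN⟩ := (mem_closure_iff_frequently.1 hx₁).and_eventually hev |>.exists
  refine ha ?_ (subset_closure hz)
  have hseq : ballSeq d (firstTrue z) (K + 1) = nextBall d s a := by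
    simp only [ballSeq]
    rw [ballSeq_congr d fun i hi => (hzN i (le_of_lt hi)).trans (hrow i hi), hzN K self_mem_Iic, hlast]
  rw [← hseq]
  exact hf z (K + 1)

end Decode

theorem exists_forall_notMem_of_polishSpace {P : Type} [TopologicalSpace P] [PolishSpace P]
    [Nonempty P] {J : Type} (hJ : #J < covMeager) (N : J → Set P)
    (hN : ∀ j, IsNowhereDense (N j)) : ∃ p, ∀ j, p ∉ N j := by
  let := TopologicalSpace.upgradeIsCompletelyMetrizable P
  let d := TopologicalSpace.denseSeq P
  choose f hf using fun x => exists_mem_closedBall_ballSeq d (firstTrue x)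
  obtain ⟨x, hx⟩ := exists_forall_notMem_of_lt_covMeager hJ (fun j => f ⁻¹' N j) fun j =>
    isNowhereDense_preimage_of_mem_ballSeq (TopologicalSpace.denseRange_denseSeq P) hf (hN j)
  exact ⟨f x, hx⟩

/-! ### Free sets -/

section Free

variable {X J : Type} {n : J → ℕ} {C : ∀ j, Set (Fin (n j) → X)}

/-- No injective tuple from `A` lies in any of the relations `C j`. -/
def IsFree (C : ∀ j, Set (Fin (n j) → X)) (A : Set X) : Prop :=
  ∀ j (x : Fin (n j) → X), Function.Injective x → (∀ k, x k ∈ A) → x ∉ C j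

theorem IsFree.mono {A B : Set X} (hB : IsFree C B) (h : A ⊆ B) : IsFree C A :=
  fun j x hx hxA => hB j x hx fun k => h (hxA k)

theorem isFree_iUnion_of_directed {I : Type} [Nonempty I] {A : I → Set X}
    (hdir : Directed (· ⊆ ·) A) (hA : ∀ i, IsFree C (A i)) : IsFree C (⋃ i, A i) := by
  intro j x hx hxA
  choose i hi using fun k => mem_iUnion.1 (hxA k)
  obtain ⟨m, hm⟩ := hdir.finite_le i
  exact hA m j x hx fun k => hm k (hi k)

theorem isFree_union_biUnion {T : Type} [LinearOrder T] {D : Set X} {S : T → Set X} {I : Set T}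
    (hD : IsFree C D) (h : ∀ t ∈ I, IsFree C (D ∪ ⋃ s ∈ Iic t, S s)) :
    IsFree C (D ∪ ⋃ s ∈ I, S s) := by
  rcases isEmpty_or_nonempty I with hemp | hne
  · simpa [isEmpty_coe_sort.1 hemp] using hD
  · have hdir : Directed (· ⊆ ·) fun t : I => D ∪ ⋃ s ∈ Iic t.1, S s :=
      Monotone.directed_le fun t t' htt' =>
        union_subset_union_right D (biUnion_subset_biUnion_left (Iic_subset_Iic.2 htt'))
    refine (isFree_iUnion_of_directed hdir fun t => h t t.2).mono
      (union_subset ?_ (iUnion₂_subset fun t ht => ?_))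
    · exact subset_union_left.trans (subset_iUnion_of_subset hne.some subset_rfl)
    · exact ((subset_biUnion_of_mem (u := S) (self_mem_Iic (a := t))).trans
        subset_union_right).trans
        (subset_iUnion (fun t : I => D ∪ ⋃ s ∈ Iic t.1, S s) ⟨t, ht⟩)

theorem injective_update_of_injOn {m : ℕ} {y : Fin m → X} {k : Fin m} (hy : InjOn y {k}ᶜ) {q : X}
    (hq : q ∉ range y) : Function.Injective (Function.update y k q) := by
  intro a b hab
  by_cases ha : a = k <;> by_cases hb : b = k
  · rw [ha, hb]
  · subst ha
    rw [Function.update_self, Function.update_of_ne hb] at hab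
    exact absurd ⟨b, hab.symm⟩ hq
  · subst hb
    rw [Function.update_self, Function.update_of_ne ha] at hab
    exact absurd ⟨a, hab⟩ hq
  · rw [Function.update_of_ne ha, Function.update_of_ne hb] at hab
    exact hy ha hb hab

variable [TopologicalSpace X]

theorem isOpenMap_comp_of_injective {m : ℕ} {e : Fin m → ℕ} (he : Function.Injective e) :
    IsOpenMap fun z : ℕ → X => z ∘ e := by
  refine IsOpenMap.of_sections fun z => ⟨fun u => Function.extend e u z, ?_, ?_, ?_⟩
  · refine Continuous.continuousAt (continuous_pi fun i => ?_)
    by_cases hi : ∃ k, e k = i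
    · obtain ⟨k, rfl⟩ := hi
      simpa [he.extend_apply] using continuous_apply k
    · simpa [Function.extend_apply' _ _ _ hi] using continuous_const
  · funext i
    by_cases hi : ∃ k, e k = i
    · obtain ⟨k, rfl⟩ := hi
      simp [he.extend_apply]
    · simp [Function.extend_apply' _ _ _ hi]
  · intro u
    funext k
    simp [he.extend_apply]

theorem exists_countable_dense_isFree [PolishSpace X] [Nonempty X] (hMA : covMeager = 𝔠)
    (hJ : #J < 𝔠) (hC : ∀ j, IsNowhereDense (C j)) :
    ∃ D : Set X, D.Countable ∧ Dense D ∧ IsFree C D := by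
  let B := TopologicalSpace.countableBasis X
  let N : B ⊕ (Σ j, Fin (n j) → ℕ) → Set (ℕ → X) := Sum.elim
    (fun b => {z | ∀ i, z i ∉ (b : Set X)})
    (fun t => {z | Function.Injective t.2 ∧ z ∘ t.2 ∈ C t.1})
  have hcard : #(B ⊕ (Σ j, Fin (n j) → ℕ)) < covMeager := by
    rw [hMA, mk_sum, lift_id, lift_id]
    refine add_lt_of_lt aleph0_le_continuum
      ((TopologicalSpace.countable_countableBasis X).le_aleph0.trans_lt aleph0_lt_continuum) ?_
    rw [mk_sigma]
    refine (sum_le_sum _ (fun _ => ℵ₀) fun j => mk_le_aleph0).trans_lt ?_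
    rw [sum_const']
    exact mul_lt_of_lt aleph0_le_continuum hJ aleph0_lt_continuum
  have hN : ∀ t, IsNowhereDense (N t) := by
    rintro (⟨b, hb⟩ | ⟨j, e⟩)
    · have hclosed : IsClosed {z : ℕ → X | ∀ i, z i ∉ b} := by
        rw [ofPred_forall]
        have hb' : IsClosed bᶜ := (TopologicalSpace.isOpen_of_mem_countableBasis hb).isClosed_compl
        exact isClosed_iInter fun i => hb'.preimage (continuous_apply (A := fun _ => X) i)
      refine hclosed.isNowhereDense_iff.2 (eq_empty_iff_forall_notMem.2 fun z hz => ?_)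
      obtain ⟨x, hx⟩ := TopologicalSpace.nonempty_of_mem_countableBasis hb
      have hlim : Tendsto (fun k : ℕ => Function.update z k x) atTop (𝓝 z) := by
        refine tendsto_pi_nhds.2 fun i => tendsto_const_nhds.congr' ?_
        filter_upwards [eventually_gt_atTop i] with k hk
        simp [Function.update_of_ne hk.ne]
      obtain ⟨k, hk⟩ := (hlim.eventually (isOpen_interior.mem_nhds hz)).exists
      exact interior_subset hk k (by simpa using hx)
    · by_cases he : Function.Injective e
      · have hcont : Continuous fun z : ℕ → X => z ∘ e :=
          continuous_pi fun k => continuous_apply (e k)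
        have hpre : IsNowhereDense ((fun z : ℕ → X => z ∘ e) ⁻¹' C j) := by
          rw [IsNowhereDense,
            ← (isOpenMap_comp_of_injective he).preimage_closure_eq_closure_preimage hcont,
            ← (isOpenMap_comp_of_injective he).preimage_interior_eq_interior_preimage hcont, hC j,
            preimage_empty]
        exact hpre.mono fun z hz => hz.2
      · exact isNowhereDense_empty.mono fun z hz => he hz.1
  obtain ⟨z, hz⟩ := exists_forall_notMem_of_polishSpace hcard N hN
  refine ⟨range z, countable_range z, ?_, ?_⟩
  · refine (TopologicalSpace.isBasis_countableBasis X).dense_iff.2 fun b hb _ => ?_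
    have := hz (Sum.inl ⟨b, hb⟩)
    simp only [N, Sum.elim_inl, mem_ofPred_eq, not_forall, not_not] at this
    obtain ⟨i, hi⟩ := this
    exact ⟨z i, hi, i, rfl⟩
  · intro j x hx hxz hxC
    choose e he using hxz
    have hze : z ∘ e = x := funext he
    refine hz (Sum.inr ⟨j, e⟩) ⟨Function.Injective.of_comp (f := z) (hze ▸ hx), ?_⟩
    simpa [hze] using hxC

/-- Each open set meeting `Q` contains infinitely many points of `Q` inside each `G k`. -/
def IsSpread (Q : Set X) (G : ℕ → Set X) : Prop :=
  ∀ V, IsOpen V → (V ∩ Q).Nonempty → ∀ k, (V ∩ Q ∩ G k).Infinite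

theorem isNowhereDense_preimage_val_closure {Q K : Set X} (hK : IsClosed K)
    (h : ∀ V, IsOpen V → (V ∩ Q).Nonempty → ∃ q ∈ V ∩ Q, q ∉ K) :
    IsNowhereDense (Subtype.val ⁻¹' K : Set (closure Q)) := by
  refine (hK.preimage continuous_subtype_val).isNowhereDense_iff.2
    (eq_empty_iff_forall_notMem.2 fun p hp => ?_)
  obtain ⟨V, hV, hVeq⟩ := isOpen_induced_iff.1
    (isOpen_interior (s := (Subtype.val ⁻¹' K : Set (closure Q))))
  have hpV : (p : X) ∈ V := by
    rw [← hVeq] at hp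
    exact hp
  obtain ⟨q, hq, hqK⟩ := h V hV (mem_closure_iff.1 p.2 V hV hpV)
  have : (⟨q, subset_closure hq.2⟩ : closure Q) ∈ Subtype.val ⁻¹' V := hq.1
  rw [hVeq] at this
  exact hqK (interior_subset (s := Subtype.val ⁻¹' K) this)

theorem exists_isFree_insert [PolishSpace X] (hMA : covMeager = 𝔠) (hJ : #J < 𝔠)
    (hC : ∀ j, IsClosed (C j)) {A Q : Set X} (hA : IsFree C A) (hcard : #A < 𝔠) (hQA : Q ⊆ A)
    (hQ : Q.Nonempty) {G : ℕ → Set X} (hG : ∀ k, IsOpen (G k)) (hQG : IsSpread Q G) :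
    ∃ p ∈ closure Q, (∀ k, p ∈ G k) ∧ IsFree C (insert p A) := by
  let L : (Σ j, Fin (n j) × (Fin (n j) → A)) → Set X := fun t =>
    {z | Function.update (fun i => (t.2.2 i : X)) t.2.1 z ∈ C t.1}
  let N : ℕ ⊕ (Σ j, Fin (n j) × (Fin (n j) → A)) → Set (closure Q) := Sum.elim
    (fun k => Subtype.val ⁻¹' (G k)ᶜ)
    (fun t => {z | InjOn (fun i => (t.2.2 i : X)) {t.2.1}ᶜ ∧ z.1 ∈ L t})
  have hcardN : #(ℕ ⊕ (Σ j, Fin (n j) × (Fin (n j) → A))) < covMeager := by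
    rw [hMA, mk_sum, lift_id, lift_id, mk_sigma]
    refine add_lt_of_lt aleph0_le_continuum (mk_le_aleph0.trans_lt aleph0_lt_continuum) ?_
    refine (sum_le_sum _ (fun _ => max #A ℵ₀) fun j => ?_).trans_lt ?_
    · rw [mk_prod, lift_id, lift_id]
      refine mul_le_of_le (le_max_right _ _) (mk_le_aleph0.trans (le_max_right _ _)) ?_
      rw [← power_def, mk_fin]
      exact power_nat_le_max
    · rw [sum_const']
      exact mul_lt_of_lt aleph0_le_continuum hJ (max_lt hcard aleph0_lt_continuum)
  have hN : ∀ t, IsNowhereDense (N t) := by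
    rintro (k | ⟨j, k, y⟩)
    · refine isNowhereDense_preimage_val_closure (hG k).isClosed_compl fun V hV hne => ?_
      obtain ⟨q, hq, hqG⟩ := (hQG V hV hne k).nonempty
      exact ⟨q, hq, not_not.2 hqG⟩
    · by_cases hy : InjOn (fun i => (y i : X)) {k}ᶜ
      · refine IsNowhereDense.mono (fun z hz => hz.2)
          (isNowhereDense_preimage_val_closure (K := L ⟨j, k, y⟩)
            ((hC j).preimage (continuous_const.update k continuous_id)) fun V hV hne => ?_)
        obtain ⟨q, hq, hqy⟩ := (hQG V hV hne 0).exists_notMem_finite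
          (finite_range fun i => (y i : X))
        refine ⟨q, hq.1, hA j _ (injective_update_of_injOn hy hqy) fun i => ?_⟩
        by_cases hi : i = k
        · subst hi
          simpa using hQA hq.1.2
        · simp [hi]
      · exact isNowhereDense_empty.mono fun z hz => hy hz.1
  have : PolishSpace (closure Q) := isClosed_closure.polishSpace
  obtain ⟨a, haQ⟩ := hQ
  have : Nonempty (closure Q) := ⟨a, subset_closure haQ⟩
  obtain ⟨p, hp⟩ := exists_forall_notMem_of_polishSpace hcardN N hN
  refine ⟨p, p.2, fun k => not_not.1 (hp (Sum.inl k)), fun j x hx hxA hxC => ?_⟩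
  by_cases hk : ∃ k, x k = p
  · obtain ⟨k, hk⟩ := hk
    have hmem : ∀ i, i ≠ k → x i ∈ A := fun i hi =>
      (hxA i).resolve_left fun h => hi (hx (h.trans hk.symm))
    classical
    let y : Fin (n j) → A := fun i => if h : i = k then ⟨a, hQA haQ⟩ else ⟨x i, hmem i h⟩
    have hyx : ∀ i, i ≠ k → (y i : X) = x i := fun i hi => by simp [y, hi]
    refine hp (Sum.inr ⟨j, k, y⟩) ⟨fun b hb c hc hbc => hx ?_, ?_⟩
    · rw [← hyx b hb, ← hyx c hc]
      exact hbc
    · have hupd : Function.update (fun i => (y i : X)) k p = x := by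
        funext i
        by_cases hi : i = k
        · subst hi
          simp [hk]
        · simp [hi, hyx i hi]
      simpa [L, hupd] using hxC
  · push Not at hk
    exact hA j x hx (fun k => (hxA k).resolve_left (hk k)) hxC

end Free

/-! ### Transfinite construction -/

/-- Recursion along a well-order whose proper initial segments are smaller than the type. -/
theorem exists_transfinite_sequence {X T : Type} (p : T → Set X → Set X → Prop)
    (h : ∀ t A, ∃ B, p t A B) :
    ∃ (_ : LinearOrder T) (_ : WellFoundedLT T) (S : T → Set X),
      (∀ t : T, #(Iio t) < #T) ∧ ∀ t, p t (⋃ s ∈ Iio t, S s) (S t) := by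
  obtain ⟨hlin, hwf, hord⟩ := exists_ord_eq_type_lt T
  choose g hg using h
  let S : T → Set X := hwf.wf.fix fun t S => g t (⋃ s, ⋃ hs : s < t, S s hs)
  refine ⟨hlin, hwf, S, fun t => mk_Iio_lt t hord, fun t => ?_⟩
  have : S t = g t (⋃ s ∈ Iio t, S s) := hwf.wf.fix_eq _ t
  rw [this]
  exact hg t _

theorem mk_le_continuum_of_polishSpace (X : Type) [TopologicalSpace X] [PolishSpace X] :
    #X ≤ 𝔠 := by
  rcases isEmpty_or_nonempty X with hX | hX
  · simp
  · obtain ⟨f, -, hf⟩ := PolishSpace.exists_nat_nat_continuous_surjective X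
    simpa using mk_le_of_surjective hf

theorem mk_opens_le_continuum (X : Type) [TopologicalSpace X] [SecondCountableTopology X] :
    #(TopologicalSpace.Opens X) ≤ 𝔠 := by
  have hB := TopologicalSpace.isBasis_countableBasis X
  have hinj : Function.Injective fun U : TopologicalSpace.Opens X =>
      {b : TopologicalSpace.countableBasis X | (b : Set X) ⊆ U} := by
    refine Function.LeftInverse.injective (g := fun S => ⟨⋃ b ∈ S, (b : Set X),
      isOpen_biUnion fun b _ => hB.isOpen b.2⟩) fun U => ?_
    refine TopologicalSpace.Opens.ext (Set.ext fun x => mem_iUnion₂.trans ⟨?_, ?_⟩)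
    · rintro ⟨b, hb, hx⟩
      exact hb hx
    · intro hx
      obtain ⟨b, hb, hxb, hbU⟩ := hB.exists_subset_of_mem_open hx U.isOpen
      exact ⟨⟨b, hb⟩, hbU, hxb⟩
  refine (mk_le_of_injective hinj).trans ?_
  rw [mk_set, ← two_power_aleph0]
  exact power_le_power_left two_ne_zero (TopologicalSpace.countable_countableBasis X).le_aleph0

section Construction

variable {X J : Type} {n : J → ℕ} {C : ∀ j, Set (Fin (n j) → X)} [TopologicalSpace X]
  [PolishSpace X]

theorem exists_dense_isFree_absorbing [Nonempty X] (hMA : covMeager = 𝔠) (hJ : #J < 𝔠)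
    (hC : ∀ j, IsClosed (C j)) (hC' : ∀ j, IsNowhereDense (C j)) :
    ∃ F : Set X, Dense F ∧ IsFree C F ∧ ∀ (Q : ℕ → X) (G : ℕ → Set X), range Q ⊆ F →
      (∀ k, IsOpen (G k)) → IsSpread (range Q) G → ∃ p ∈ F ∩ closure (range Q), ∀ k, p ∈ G k := by
  obtain ⟨D, hDc, hDd, hDf⟩ := exists_countable_dense_isFree hMA hJ hC'
  let T := (ℕ → X) × (ℕ → TopologicalSpace.Opens X)
  have hT : #T ≤ 𝔠 := by
    rw [mk_prod, lift_id, lift_id]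
    refine mul_le_of_le aleph0_le_continuum ?_ ?_ <;>
      rw [← power_def, mk_nat, ← continuum_power_aleph0]
    · exact power_le_power_right (mk_le_continuum_of_polishSpace X)
    · exact power_le_power_right (mk_opens_le_continuum X)
  let p : T → Set X → Set X → Prop := fun t A B => B.Countable ∧
    (IsFree C (D ∪ A) → IsFree C (D ∪ A ∪ B)) ∧
    (#A < 𝔠 → IsFree C (D ∪ A ∪ range t.1) → IsSpread (range t.1) (fun k => t.2 k) →
      ∃ x ∈ B ∩ closure (range t.1), ∀ k, x ∈ t.2 k)
  have hp : ∀ t A, ∃ B, p t A B := by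
    rintro ⟨Q, G⟩ A
    by_cases h : #A < 𝔠 ∧ IsFree C (D ∪ A ∪ range Q) ∧ IsSpread (range Q) (fun k => G k)
    · obtain ⟨hA, hfree, hspread⟩ := h
      have hcard : #(D ∪ A ∪ range Q : Set X) < 𝔠 :=
        (mk_union_le _ _).trans_lt (add_lt_of_lt aleph0_le_continuum
          ((mk_union_le _ _).trans_lt (add_lt_of_lt aleph0_le_continuum
            (hDc.le_aleph0.trans_lt aleph0_lt_continuum) hA))
          ((countable_range Q).le_aleph0.trans_lt aleph0_lt_continuum))
      obtain ⟨x, hxQ, hxG, hx⟩ := exists_isFree_insert hMA hJ hC hfree hcard subset_union_right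
        (range_nonempty Q) (fun k => (G k).isOpen) hspread
      refine ⟨insert x (range Q), (countable_range Q).insert x, fun _ => ?_, fun _ _ _ =>
        ⟨x, ⟨mem_insert _ _, hxQ⟩, hxG⟩⟩
      rwa [union_insert]
    · refine ⟨∅, countable_empty, fun h' => by simpa using h', fun h₁ h₂ h₃ => ?_⟩
      exact absurd ⟨h₁, h₂, h₃⟩ h
  obtain ⟨hlin, hwf, S, hsmall, hS⟩ := exists_transfinite_sequence p hp
  have hfree : ∀ t, IsFree C (D ∪ ⋃ s ∈ Iic t, S s) := by
    intro t
    induction t using hwf.induction with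
    | _ t ih =>
      rw [← Iio_insert, biUnion_insert, union_comm (S t), ← union_assoc]
      exact (hS t).2.1 (isFree_union_biUnion hDf ih)
  have hF : IsFree C (D ∪ ⋃ t, S t) := by
    simpa using isFree_union_biUnion (I := univ) hDf fun t _ => hfree t
  refine ⟨D ∪ ⋃ t, S t, hDd.mono subset_union_left, hF, fun Q G hQF hG hQG => ?_⟩
  let t : T := (Q, fun k => ⟨G k, hG k⟩)
  have hcard : #(⋃ s ∈ Iio t, S s : Set X) < 𝔠 := by
    refine (mk_biUnion_le S (Iio t)).trans_lt (mul_lt_of_lt aleph0_le_continuum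
      ((hsmall t).trans_le hT) ?_)
    exact (ciSup_le' fun s : Iio t => (hS s).1.le_aleph0).trans_lt aleph0_lt_continuum
  obtain ⟨x, ⟨hxS, hxQ⟩, hxG⟩ := (hS t).2.2 hcard
    (hF.mono (union_subset (union_subset_union_right D (iUnion₂_subset fun s _ =>
      subset_iUnion S s)) hQF)) hQG
  exact ⟨x, ⟨Or.inr (mem_iUnion.2 ⟨t, hxS⟩), hxQ⟩, hxG⟩

end Construction

/-! ### Complete Baireness -/

section Baire

variable {X : Type} [TopologicalSpace X]

theorem exists_closed_nowhereDense_cover_of_isMeagre {s : Set X} (hs : IsMeagre s) :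
    ∃ C : ℕ → Set X, (∀ k, IsClosed (C k)) ∧ (∀ k, IsNowhereDense (C k)) ∧ s ⊆ ⋃ k, C k := by
  obtain ⟨S, hS, hSc, hsS⟩ := isMeagre_iff_countable_union_isNowhereDense.1 hs
  obtain ⟨f, hf⟩ := (hSc.insert ∅).exists_eq_range (insert_nonempty _ _)
  refine ⟨fun k => closure (f k), fun k => isClosed_closure, fun k => IsNowhereDense.closure ?_,
    fun x hx => ?_⟩
  · rcases hf.symm ▸ mem_range_self k with h | h
    · exact h ▸ isNowhereDense_empty
    · exact hS _ h
  · obtain ⟨t, ht, hxt⟩ := hsS hx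
    obtain ⟨k, rfl⟩ := hf ▸ mem_insert_of_mem ∅ ht
    exact mem_iUnion.2 ⟨k, subset_closure hxt⟩

theorem baireSpace_of_isInducing {Y : Type} [TopologicalSpace Y] {e : Y → X} (he : IsInducing e)
    (h : ∀ (G : ℕ → Set X) (W : Set X), (∀ k, IsOpen (G k)) → IsOpen W →
      (∀ k V, IsOpen V → (V ∩ range e).Nonempty → (V ∩ range e ∩ G k).Nonempty) →
      (W ∩ range e).Nonempty → (W ∩ range e ∩ ⋂ k, G k).Nonempty) : BaireSpace Y := by
  refine ⟨fun f hfo hfd => dense_iff_inter_open.2 fun U hU hne => ?_⟩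
  choose G hG hGf using fun k => he.isOpen_iff.1 (hfo k)
  obtain ⟨W, hW, rfl⟩ := he.isOpen_iff.1 hU
  obtain ⟨_, ⟨hxW, y, rfl⟩, hxG⟩ := h G W hG hW (by
    rintro k V hV ⟨_, hyV, y, rfl⟩
    obtain ⟨z, hz, hzf⟩ := (hfd k).inter_open_nonempty _ (hV.preimage he.continuous) ⟨y, hyV⟩
    rw [← hGf k] at hzf
    exact ⟨e z, ⟨hz, z, rfl⟩, hzf⟩) (by
    obtain ⟨y, hy⟩ := hne
    exact ⟨e y, hy, y, rfl⟩)
  refine ⟨y, hxW, mem_iInter.2 fun k => ?_⟩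
  rw [← hGf k]
  exact mem_iInter.1 hxG k

theorem completelyBaire_of_absorbing [T1Space X] [SecondCountableTopology X] {F : Set X}
    (hF : ∀ (Q : ℕ → X) (G : ℕ → Set X), range Q ⊆ F → (∀ k, IsOpen (G k)) →
      IsSpread (range Q) G → ∃ p ∈ F ∩ closure (range Q), ∀ k, p ∈ G k)
    (K : Set F) (hK : IsClosed K) : BaireSpace K := by
  obtain ⟨K', hK', rfl⟩ := isClosed_induced_iff.1 hK
  let e : (Subtype.val ⁻¹' K' : Set F) → X := fun y => y.1.1
  have hmem : ∀ x, x ∈ range e ↔ x ∈ F ∧ x ∈ K' := fun x =>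
    ⟨by rintro ⟨y, rfl⟩; exact ⟨y.1.2, y.2⟩, fun hx => ⟨⟨⟨x, hx.1⟩, hx.2⟩, rfl⟩⟩
  refine baireSpace_of_isInducing (e := e) (IsInducing.subtypeVal.comp IsInducing.subtypeVal)
    fun G W hG hW hdense hne => ?_
  by_contra hemp
  have : Nonempty ↥(W ∩ range e) := hne.to_subtype
  let Q : ℕ → X := fun i => TopologicalSpace.denseSeq ↥(W ∩ range e) i
  have hQsub : range Q ⊆ W ∩ range e :=
    range_subset_iff.2 fun i => (TopologicalSpace.denseSeq ↥(W ∩ range e) i).2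
  have hQd : ∀ V, IsOpen V → (V ∩ (W ∩ range e)).Nonempty → (V ∩ range Q).Nonempty := by
    rintro V hV ⟨x, hxV, hx⟩
    obtain ⟨i, hi⟩ := (TopologicalSpace.denseRange_denseSeq ↥(W ∩ range e)).exists_mem_open
      (hV.preimage continuous_subtype_val) ⟨⟨x, hx⟩, hxV⟩
    exact ⟨Q i, hi, i, rfl⟩
  have hQG : ∀ V, IsOpen V → (V ∩ range Q).Nonempty → ∀ k, (V ∩ G k ∩ range Q).Nonempty := by
    rintro V hV ⟨q, hqV, hq⟩ k
    obtain ⟨x, ⟨⟨hxV, hxW⟩, hxe⟩, hxG⟩ := hdense k (V ∩ W) (hV.inter hW)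
      ⟨q, ⟨hqV, (hQsub hq).1⟩, (hQsub hq).2⟩
    exact hQd _ (hV.inter (hG k)) ⟨x, ⟨hxV, hxG⟩, hxW, hxe⟩
  have hinf : ∀ V, IsOpen V → (V ∩ range Q).Nonempty → (V ∩ range Q).Infinite := by
    rintro V hV ⟨q, hqV, hq⟩ hfin
    refine hemp ⟨q, hQsub hq, mem_iInter.2 fun k => ?_⟩
    have hopen : IsOpen (V \ ((V ∩ range Q) \ {q})) := hV.sdiff (hfin.sdiff.isClosed)
    obtain ⟨r, ⟨⟨hrV, hr⟩, hrG⟩, hrQ⟩ := hQG _ hopen ⟨q, ⟨hqV, fun h => h.2 rfl⟩, hq⟩ k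
    have : r = q := by
      by_contra hrq
      exact hr ⟨⟨hrV, hrQ⟩, hrq⟩
    exact this ▸ hrG
  obtain ⟨p, ⟨hpF, hpQ⟩, hp⟩ := hF Q (fun k => k.casesOn W G) (fun x hx =>
      ((hmem x).1 (hQsub hx).2).1) (by rintro (_ | k); exacts [hW, hG k]) (by
    rintro V hV hne (_ | k)
    · exact (hinf V hV hne).mono fun x hx => ⟨hx, (hQsub hx.2).1⟩
    · exact (hinf _ (hV.inter (hG k)) (hQG V hV hne k)).mono fun x hx =>
        ⟨⟨hx.1.1, hx.2⟩, hx.1.2⟩)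
  have hpK : p ∈ K' :=
    closure_minimal (fun x hx => ((hmem x).1 (hQsub hx).2).2) hK' hpQ
  exact hemp ⟨p, ⟨hp 0, (hmem p).2 ⟨hpF, hpK⟩⟩, mem_iInter.2 fun k => hp (k + 1)⟩

end Baire

end CompletelyBaireFree

open CompletelyBaireFree in
theorem maincb_completely_baire_free {X : Type} [TopologicalSpace X] [PolishSpace X]
    [Nonempty X] (hX : Perfect (Set.univ : Set X))
    (hd : dNumber = Cardinal.continuum) (hMA : covMeager = Cardinal.continuum)
    {ι : Type} (hι : Cardinal.mk ι < Cardinal.continuum) (n : ι → ℕ) (hn : ∀ i, 1 ≤ n i)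
    (R : ∀ i, Set (Fin (n i) → X)) (hR : ∀ i, IsMeagre (R i)) :
    ∃ F : Set X, Dense F ∧ (∀ C : Set ↥F, IsClosed C → BaireSpace ↥C) ∧
      ∀ i (x : Fin (n i) → X), Function.Injective x → (∀ k, x k ∈ F) → x ∉ R i := by
  choose C hC hC' hRC using fun i => exists_closed_nowhereDense_cover_of_isMeagre (hR i)
  obtain ⟨F, hFd, hFf, hF⟩ := exists_dense_isFree_absorbing (J := ι × ℕ)
    (C := fun j => C j.1 j.2) hMA
    (by
      rw [mk_prod, lift_id, lift_id, mk_nat]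
      exact mul_lt_of_lt aleph0_le_continuum hι aleph0_lt_continuum)
    (fun j => hC j.1 j.2) (fun j => hC' j.1 j.2)
  refine ⟨F, hFd, completelyBaire_of_absorbing hF, fun i x hx hxF hxR => ?_⟩
  obtain ⟨k, hk⟩ := mem_iUnion.1 (hRC i hxR)
  exact hFf (i, k) x hx hxF hk
end

section
/- There exists an independent family on ω that is non-meager as a subset of 2^ω. -/
def IndepFamily (A : Set (ℕ → Bool)) : Prop :=
  ∀ F : Finset (ℕ → Bool), ↑F ⊆ A → F.Nonempty → ∀ ν : (ℕ → Bool) → Bool,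
    {m : ℕ | ∀ x ∈ F, x m = ν x}.Infinite

/-- Flipping one coordinate, as a homeomorphism of the Cantor space. -/
def flipHomeomorph (m : ℕ) : (ℕ → Bool) ≃ₜ (ℕ → Bool) where
  toFun x := Function.update x m (!x m)
  invFun x := Function.update x m (!x m)
  left_inv x := by simp
  right_inv x := by simp
  continuous_toFun := by fun_prop
  continuous_invFun := by fun_prop

theorem exists_block_of_isOpen_dense (m : ℕ) :
    ∀ G : Set (ℕ → Bool), IsOpen G → Dense G → ∃ (t : ℕ → Bool) (m' : ℕ),
      ∀ y : ℕ → Bool, (∀ p, m ≤ p → p < m' → y p = t p) → y ∈ G := by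
  induction m with
  | zero =>
    intro G hG hd
    obtain ⟨t, ht⟩ := hd.nonempty
    obtain ⟨I, u, hu, hI⟩ := isOpen_pi_iff.1 hG t ht
    refine ⟨t, I.sup id + 1, fun y hy => hI fun i hi => ?_⟩
    rw [hy i (Nat.zero_le _) (Nat.lt_succ_of_le (Finset.le_sup (f := id) hi))]
    exact (hu i hi).2
  | succ m ih =>
    intro G hG hd
    obtain ⟨t, m', h⟩ := ih (G ∩ flipHomeomorph m ⁻¹' G)
      (hG.inter (hG.preimage (flipHomeomorph m).continuous))
      (hd.inter_of_isOpen_left (hd.preimage (flipHomeomorph m).isOpenMap) hG)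
    refine ⟨t, m', fun y hy => ?_⟩
    by_cases hm : y m = t m
    · refine (h y fun p hp hp' => ?_).1
      rcases hp.eq_or_lt with rfl | hp
      · exact hm
      · exact hy p hp hp'
    · have := (h (flipHomeomorph m y) fun p hp hp' => ?_).2
      · rw [Set.mem_preimage] at this
        rwa [show flipHomeomorph m (flipHomeomorph m y) = y from
          (flipHomeomorph m).left_inv y] at this
      · change Function.update y m (!y m) p = t p
        rcases hp.eq_or_lt with rfl | hp
        · cases h1 : y m <;> cases h2 : t m <;> simp_all
        · rw [Function.update_of_ne hp.ne']
          exact hy p hp hp'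

theorem StrictMono.exists_mem_Ico {k : ℕ → ℕ} (hk : StrictMono k) (h0 : k 0 = 0) (s : ℕ) :
    ∃ i, k i ≤ s ∧ s < k (i + 1) := by
  induction s with
  | zero => exact ⟨0, h0.le, (Nat.zero_le _).trans_lt (hk (Nat.lt_succ_self 0))⟩
  | succ s ih =>
    obtain ⟨i, hi, hi'⟩ := ih
    rcases (Nat.succ_le_of_lt hi').eq_or_lt with h | h
    · exact ⟨i + 1, h.ge, h.le.trans_lt (hk (Nat.lt_succ_self (i + 1)))⟩
    · exact ⟨i, by omega, h⟩

/-- A countable intersection of dense open sets contains a point which, along an ultrafilter `U`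
in the variable `s`, agrees with `φ n` at `s * s + n`, for every `n`. -/
theorem exists_mem_iInter_eventually_eq (U : Ultrafilter ℕ) (hU : (U : Filter ℕ) ≤ Filter.atTop)
    (G : ℕ → Set (ℕ → Bool)) (hG : ∀ j, IsOpen (G j)) (hd : ∀ j, Dense (G j)) (φ : ℕ → Bool) :
    ∃ y ∈ ⋂ j, G j, ∀ n, ∀ᶠ s in (U : Filter ℕ), y (s * s + n) = φ n := by
  have step : ∀ i m : ℕ, ∃ (m' : ℕ) (t : ℕ → Bool), m < m' ∧ ∀ y : ℕ → Bool,
      (∀ p, m ≤ p.sqrt → p.sqrt < m' → y p = t p) → ∀ j ≤ i, y ∈ G j := by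
    intro i m
    have hD : IsOpen (⋂ j ∈ Finset.range (i + 1), G j) ∧
        Dense (⋂ j ∈ Finset.range (i + 1), G j) :=
      ⟨isOpen_biInter_finset fun j _ => hG j,
        dense_biInter_of_isOpen (fun j _ => hG j) (Finset.countable_toSet _) fun j _ => hd j⟩
    obtain ⟨t, M, h⟩ := exists_block_of_isOpen_dense (m * m) _ hD.1 hD.2
    refine ⟨max (m + 1) M, t, by simp, fun y hy j hj => ?_⟩
    have := h y fun p hp hp' => hy p (Nat.le_sqrt.2 hp)
      (lt_max_of_lt_right ((Nat.sqrt_le_self p).trans_lt hp'))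
    simp only [Set.mem_iInter, Finset.mem_range] at this
    exact this j (Nat.lt_succ_of_le hj)
  choose next t hlt ht using step
  let k : ℕ → ℕ := fun i => Nat.rec 0 (fun i m => next i m) i
  have hk : StrictMono k := strictMono_nat_of_lt_succ fun i => hlt i (k i)
  choose idx hidx hidx' using hk.exists_mem_Ico rfl
  have hidx_eq : ∀ i s, k i ≤ s → s < k (i + 1) → idx s = i := fun i s h h' => by
    have h1 : idx s < i + 1 := hk.lt_iff_lt.1 (LE.le.trans_lt (hidx s) h')
    have h2 : i < idx s + 1 := hk.lt_iff_lt.1 (h.trans_lt (hidx' s))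
    omega
  obtain ⟨E, hE, hE'⟩ : ∃ E : Set ℕ, (∀ᶠ s in (U : Filter ℕ), idx s ∈ E) ∧
      ∀ j, ∃ i ≥ j, i ∉ E := by
    by_cases h : ∀ᶠ s in (U : Filter ℕ), Even (idx s)
    · exact ⟨{i | Even i}, h, fun j => ⟨2 * j + 1, by omega, by simp⟩⟩
    · exact ⟨{i | ¬ Even i}, Ultrafilter.eventually_not.2 h,
        fun j => ⟨2 * j, by omega, by simp⟩⟩
  classical
  refine ⟨fun p => if idx p.sqrt ∈ E then φ (p - p.sqrt * p.sqrt) else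
    t (idx p.sqrt) (k (idx p.sqrt)) p, Set.mem_iInter.2 fun j => ?_, fun n => ?_⟩
  · obtain ⟨i, hij, hi⟩ := hE' j
    refine ht i (k i) _ (fun p hp hp' => ?_) j hij
    rw [hidx_eq i p.sqrt hp hp', if_neg hi]
  · filter_upwards [hE, hU (Filter.eventually_ge_atTop n)] with s hs hn
    have hn : n ≤ s := hn
    have hsq : (s * s + n).sqrt = s := Nat.sqrt_add_eq s (by omega)
    simp [hsq, hs]

/-- Finitely many points of the Cantor space are separated by an initial segment. -/
theorem exists_injOn_filter_range (F : Finset (ℕ → Bool)) :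
    ∃ N, Set.InjOn (fun x : ℕ → Bool => (Finset.range N).filter fun i => x i = true)
      (F : Set (ℕ → Bool)) := by
  have hdiff : ∀ q : (ℕ → Bool) × (ℕ → Bool), ∃ i, q.1 ≠ q.2 → q.1 i ≠ q.2 i := fun q => by
    by_cases h : q.1 = q.2
    · exact ⟨0, fun h' => (h' h).elim⟩
    · obtain ⟨i, hi⟩ := Function.ne_iff.1 h
      exact ⟨i, fun _ => hi⟩
  choose d hd using hdiff
  refine ⟨(F ×ˢ F).sup d + 1, fun x hx y hy hxy => ?_⟩
  by_contra hne
  refine hd (x, y) hne (Bool.eq_iff_iff.2 ?_)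
  have hlt : d (x, y) < (F ×ˢ F).sup d + 1 :=
    Nat.lt_succ_of_le (Finset.le_sup (Finset.mk_mem_product hx hy))
  simpa [hlt] using Finset.ext_iff.1 hxy (d (x, y))

/-- There is an independent family of subsets of `ℕ` indexed by the Cantor space. -/
theorem exists_independent_of_cantor :
    ∃ φ : (ℕ → Bool) → ℕ → Bool, ∀ (F : Finset (ℕ → Bool)) (ν : (ℕ → Bool) → Bool),
      ∃ n, ∀ x ∈ F, φ x n = ν x := by
  obtain ⟨e, he⟩ := exists_surjective_nat (ℕ × Finset (Finset ℕ))
  refine ⟨fun x n => decide (((Finset.range (e n).1).filter fun i => x i = true) ∈ (e n).2),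
    fun F ν => ?_⟩
  obtain ⟨N, hN⟩ := exists_injOn_filter_range F
  obtain ⟨n, hn⟩ := he (N, (F.filter fun x => ν x = true).image
    fun x : ℕ → Bool => (Finset.range N).filter fun i => x i = true)
  refine ⟨n, fun x hx => ?_⟩
  beta_reduce
  rw [hn, Bool.eq_iff_iff, decide_eq_true_iff, Finset.mem_image]
  constructor
  · rintro ⟨y, hy, hyx⟩
    rw [Finset.mem_filter] at hy
    exact hN hy.1 hx hyx ▸ hy.2
  · exact fun h => ⟨x, Finset.mem_filter.2 ⟨hx, h⟩, rfl⟩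

theorem exists_injective_measurableSet_cantor :
    ∃ c : {s : Set (ℕ → Bool) // MeasurableSet s} → (ℕ → Bool), Function.Injective c := by
  have h : Cardinal.mk {s : Set (ℕ → Bool) // MeasurableSet s} ≤ Cardinal.mk (ℕ → Bool) := by
    obtain ⟨b, hb, hgen⟩ :=
      MeasurableSpace.CountablyGenerated.isCountablyGenerated (α := ℕ → Bool)
    have hle := MeasurableSpace.cardinal_measurableSet_le_continuum
      (hb.le_aleph0.trans Cardinal.aleph0_le_continuum)
    rw [← hgen] at hle
    exact hle.trans_eq (by simp)
  obtain ⟨c⟩ := h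
  exact ⟨c, c.injective⟩

theorem exists_nonmeager_independent :
    ∃ A : Set (ℕ → Bool), IndepFamily A ∧ ¬ IsMeagre A := by
  obtain ⟨φ, hφ⟩ := exists_independent_of_cantor
  obtain ⟨c, hc⟩ := exists_injective_measurableSet_cantor
  let U : Ultrafilter ℕ := Filter.hyperfilter ℕ
  have hU : (U : Filter ℕ) ≤ Filter.atTop := Nat.hyperfilter_le_atTop
  have hpoint : ∀ S : {s : Set (ℕ → Bool) // MeasurableSet s}, S.1 ∈ residual (ℕ → Bool) →
      ∃ y ∈ S.1, ∀ n, ∀ᶠ s in (U : Filter ℕ), y (s * s + n) = φ (c S) n := by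
    intro S hS
    obtain ⟨T, hTS, hT, hTd⟩ := mem_residual.1 hS
    obtain ⟨G, hG, rfl⟩ := isGδ_iff_eq_iInter_nat.1 hT
    obtain ⟨y, hy, hyφ⟩ := exists_mem_iInter_eventually_eq U hU G hG
      (fun j => hTd.mono (Set.iInter_subset _ j)) (φ (c S))
    exact ⟨y, hTS hy, hyφ⟩
  choose! y hy hyφ using hpoint
  refine ⟨{x | ∃ S, S.1 ∈ residual (ℕ → Bool) ∧ y S = x}, fun F hF _ ν => ?_, fun hA => ?_⟩
  · have hF' : ∀ x ∈ F, ∃ S : {s : Set (ℕ → Bool) // MeasurableSet s},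
        S.1 ∈ residual (ℕ → Bool) ∧ y S = x := fun x hx => hF hx
    choose! S hS hSx using hF'
    have hinj : ∀ x ∈ F, ∀ x' ∈ F, c (S x) = c (S x') → x = x' := fun x hx x' hx' h => by
      rw [← hSx x hx, ← hSx x' hx', hc h]
    classical
    obtain ⟨n, hn⟩ := hφ (F.image fun x => c (S x))
      fun z => ν (Function.invFunOn (fun x => c (S x)) F z)
    have hev : ∀ᶠ s in (U : Filter ℕ), ∀ x ∈ F, x (s * s + n) = ν x := by
      refine (Filter.eventually_all_finset F).2 fun x hx => ?_
      filter_upwards [hyφ (S x) (hS x hx) n] with s hs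
      rw [hSx x hx] at hs
      rw [hs, hn _ (Finset.mem_image_of_mem _ hx)]
      congr 1
      have hex : ∃ a ∈ (F : Set (ℕ → Bool)), c (S a) = c (S x) := ⟨x, hx, rfl⟩
      exact hinj _ (Function.invFunOn_mem hex) _ hx (Function.invFunOn_eq hex)
    have hinf : {s : ℕ | ∀ x ∈ F, x (s * s + n) = ν x}.Infinite :=
      Nat.frequently_atTop_iff_infinite.1 (hev.frequently.filter_mono hU)
    refine Set.infinite_of_injOn_mapsTo (f := fun s => s * s + n) (fun a _ b _ h => ?_)
      (fun s hs => hs) hinf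
    exact Nat.mul_self_inj.1 (Nat.add_right_cancel h)
  · obtain ⟨T, hTA, hT, hTd⟩ := mem_residual.1 hA
    have hTr : T ∈ residual (ℕ → Bool) := residual_of_dense_Gδ hT hTd
    exact hTA (hy ⟨T, hT.measurableSet⟩ hTr) ⟨⟨T, hT.measurableSet⟩, hTr, rfl⟩
end

section
/- Assume 𝔡 = 𝔠. Then there exists an independent family 𝓐 on ω that is dense in 2^ω and completely Baire as a subspace of 2^ω. -/
open Cardinal Set PiNat

theorem exists_frequently_lt (hd : dNumber = 𝔠) {ι : Type} (hι : #ι < 𝔠) (H : ι → ℕ → ℕ) :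
    ∃ f : ℕ → ℕ, ∀ i, ∃ᶠ m in Filter.atTop, H i m < f m := by
  by_contra! h
  have : dNumber ≤ #(range H) := csInf_le' ⟨range H, rfl, fun g => by
    obtain ⟨i, hi⟩ := h g
    exact ⟨H i, mem_range_self i, by simpa [Filter.not_frequently] using hi⟩⟩
  exact (this.trans mk_range_le).not_gt (hd ▸ hι)

/-- For every `k`, each term of `q` is a limit of distinct terms `q n` with `n ∈ D k`. -/
def Recurrent (q : ℕ → ℕ → Bool) (D : ℕ → Set ℕ) : Prop :=
  ∀ k n M, ∃ n' ∈ D k, q n' ∈ cylinder (q n) M ∧ ∀ j ≤ n, q n' ≠ q j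

theorem exists_cylinder_subset {U : Set (ℕ → Bool)} (hU : IsOpen U) {x : ℕ → Bool} (hx : x ∈ U) :
    ∃ n, cylinder x n ⊆ U := by
  obtain ⟨s, ⟨y, n, rfl⟩, hxs, hs⟩ :=
    (isTopologicalBasis_cylinders (fun _ : ℕ => Bool)).exists_subset_of_mem_open hx hU
  exact ⟨n, by rwa [mem_cylinder_iff_eq.1 hxs]⟩

/-- If consecutive terms of a sequence agree up to lengths `a k > k` that do not decrease, then the
sequence has a limit agreeing with the `k`-th term up to length `a k`. -/
theorem exists_limit {u : ℕ → ℕ → Bool} {a : ℕ → ℕ} (ha : Monotone a) (hk : ∀ k, k < a k)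
    (hu : ∀ k, u (k + 1) ∈ cylinder (u k) (a k)) : ∃ x, ∀ k, x ∈ cylinder (u k) (a k) := by
  have key : ∀ k j, k ≤ j → u j ∈ cylinder (u k) (a k) := by
    intro k j hkj
    induction j, hkj using Nat.le_induction with
    | base => exact self_mem_cylinder _ _
    | succ j hkj ih => exact fun m hm => (hu j m (hm.trans_le (ha hkj))).trans (ih m hm)
  refine ⟨fun m => u m m, fun k m hm => ?_⟩
  rcases le_total k m with h | h
  · exact key k m h m hm
  · exact (key m k h m (hk m)).symm

/-- If `𝔡 = 𝔠`, fewer than `𝔠` closed sets with finitely many points on a recurrent sequence `q` do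
not cover the limits of `q` that lie in all the open sets determined by `D` and `r`. -/
theorem exists_mem_closure_avoiding (hd : dNumber = 𝔠) {q : ℕ → ℕ → Bool} {D : ℕ → Set ℕ}
    (hq : Recurrent q D) (r : ℕ → ℕ → ℕ) {ι : Type} (hι : #ι < 𝔠) {K : ι → Set (ℕ → Bool)}
    (hK : ∀ i, IsClosed (K i)) (hfin : ∀ i, (range q ∩ K i).Finite) :
    ∃ x ∈ closure (range q), (∀ k, ∃ n ∈ D k, x ∈ cylinder (q n) (r k n)) ∧ ∀ i, x ∉ K i := by
  choose N hND hNq hN using hq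
  let step (k : ℕ) (s : ℕ × ℕ) (m : ℕ) : ℕ × ℕ :=
    (N k s.1 (max (s.2 + 1) m),
      max (max (s.2 + 1) m) (r k (N k s.1 (max (s.2 + 1) m))))
  have hg : ∀ i n, ∃ g, q n ∉ K i → cylinder (q n) g ⊆ (K i)ᶜ := fun i n => by
    by_cases h : q n ∈ K i
    · exact ⟨0, fun h' => absurd h h'⟩
    · exact (exists_cylinder_subset (hK i).isOpen_compl h).imp fun _ hg _ => hg
  choose g hg using hg
  let T (i : ι) (l : ℕ) (s : ℕ × ℕ) (j : ℕ) : Finset (ℕ × ℕ) :=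
    Nat.rec {s} (fun j t => t.biUnion fun s => (Finset.range (g i s.1)).image (step (l + j) s)) j
  have hcard : #(ι × ℕ × ℕ × ℕ) < 𝔠 := by
    have h0 : #(ℕ × ℕ × ℕ) < 𝔠 := by simpa using aleph0_lt_continuum
    rw [mk_prod, lift_id, lift_id]
    exact mul_lt_of_lt aleph0_le_continuum hι h0
  obtain ⟨f, hf⟩ := exists_frequently_lt hd hcard
    fun p m => (T p.1 p.2.1 p.2.2 (m - p.2.1)).sup fun s => g p.1 s.1
  let p (k : ℕ) : ℕ × ℕ := Nat.rec (0, 0) (fun k s => step k s (f k)) k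
  have hp : ∀ k, p (k + 1) = step k (p k) (f k) := fun k => rfl
  let a (k : ℕ) : ℕ := max ((p k).2 + 1) (f k)
  have hap : ∀ k, a k ≤ (p (k + 1)).2 := fun k => le_max_left _ _
  have hpa : ∀ k, (p k).2 < a k := fun k => Nat.lt_of_succ_le (le_max_left _ _)
  have ha : StrictMono a := strictMono_nat_of_lt_succ fun k => (hap k).trans_lt (hpa (k + 1))
  have hka : ∀ k, k < a k := fun k => by
    induction k with
    | zero => exact (Nat.zero_le _).trans_lt (hpa 0)
    | succ k ih => exact (Nat.succ_le_of_lt ih).trans_lt (ha k.lt_succ_self)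
  obtain ⟨x, hx⟩ := exists_limit (u := fun k => q (p k).1) ha.monotone hka
    fun k => hNq k (p k).1 (a k)
  have hmono : StrictMono fun k => (p k).1 := strictMono_nat_of_lt_succ fun k => by
    by_contra! h
    exact hN k (p k).1 (a k) _ h rfl
  have hinj : Function.Injective fun k => q (p k).1 := by
    refine .of_lt_imp_ne fun j k hjk => ?_
    obtain ⟨k, rfl⟩ := Nat.exists_eq_succ_of_ne_zero (Nat.ne_zero_of_lt hjk)
    exact (hN k (p k).1 (a k) _ (hmono.monotone (Nat.lt_succ_iff.1 hjk))).symm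
  refine ⟨x, ?_, fun k => ⟨(p (k + 1)).1, hND k _ _, ?_⟩, fun i hxi => ?_⟩
  · rw [mem_closure_iff]
    intro U hU hxU
    obtain ⟨n, hn⟩ := exists_cylinder_subset hU hxU
    refine ⟨_, hn ?_, mem_range_self (p n).1⟩
    rw [mem_cylinder_comm]
    exact cylinder_anti _ (hka n).le (hx n)
  · exact cylinder_anti _ ((le_max_right _ _).trans (hpa (k + 1)).le) (hx (k + 1))
  · have hev : {k | q (p k).1 ∈ K i}.Finite :=
      ((hfin i).preimage hinj.injOn).subset fun k hk => ⟨mem_range_self _, hk⟩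
    obtain ⟨b, hb⟩ := hev.bddAbove
    set l := b + 1
    have hl : ∀ k, l ≤ k → q (p k).1 ∉ K i := fun k hk h => absurd (hb h) (by omega)
    have hfg : ∀ k, l ≤ k → f k < g i (p k).1 := fun k hk => by
      by_contra! h
      exact hg i _ (hl k hk) (cylinder_anti _ (h.trans (le_max_right _ _)) (hx k)) hxi
    have hT : ∀ j, p (l + j) ∈ T i l (p l) j := by
      intro j
      induction j with
      | zero => exact Finset.mem_singleton_self _
      | succ j ih =>
        exact Finset.mem_biUnion.2 ⟨_, ih, Finset.mem_image.2
          ⟨f (l + j), Finset.mem_range.2 (hfg _ (Nat.le_add_right _ _)), rfl⟩⟩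
    obtain ⟨m, hm, hlm⟩ := ((hf (i, l, p l)).and_eventually (Filter.eventually_ge_atTop l)).exists
    have hTm := hT (m - l)
    rw [Nat.add_sub_cancel' hlm] at hTm
    exact (hm.trans (hfg m hlm)).not_ge (Finset.le_sup (f := fun s : ℕ × ℕ => g i s.1) hTm)

theorem IndepFamily.mono {A B : Set (ℕ → Bool)} (hB : IndepFamily B) (h : A ⊆ B) :
    IndepFamily A :=
  fun F hF => hB F (hF.trans h)

theorem IndepFamily.infinite {B : Set (ℕ → Bool)} (hB : IndepFamily B) {F : Finset (ℕ → Bool)}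
    (hF : ↑F ⊆ B) (ν : (ℕ → Bool) → Bool) : {m : ℕ | ∀ x ∈ F, x m = ν x}.Infinite := by
  rcases F.eq_empty_or_nonempty with rfl | h
  · simpa using infinite_univ
  · exact hB F hF h ν

/-- If `𝔡 = 𝔠`, an independent family of size less than `𝔠` containing a recurrent sequence `q` can
be extended by a limit of `q` that lies in all the open sets determined by `D` and `r`. -/
theorem IndepFamily.exists_insert (hd : dNumber = 𝔠) {B : Set (ℕ → Bool)} (hB : IndepFamily B)
    (hcard : #B < 𝔠) {q : ℕ → ℕ → Bool} {D : ℕ → Set ℕ} (hq : Recurrent q D) (r : ℕ → ℕ → ℕ)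
    (hqB : range q ⊆ B) :
    ∃ x ∈ closure (range q), (∀ k, ∃ n ∈ D k, x ∈ cylinder (q n) (r k n)) ∧
      IndepFamily (insert x B) := by
  classical
  let S (F G : Finset B) : Set ℕ := {m | ∀ y ∈ F, y.1 m = decide (y ∈ G)}
  let K (i : Finset B × Finset B × ℕ × Bool) : Set (ℕ → Bool) :=
    {y | ∀ m ∈ S i.1 i.2.1, i.2.2.1 ≤ m → y m = i.2.2.2}
  have hι : #(Finset B × Finset B × ℕ × Bool) < 𝔠 := by
    have h1 : #(Finset B) < 𝔠 := by
      rcases finite_or_infinite B with h | h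
      · exact (lt_aleph0_of_finite _).trans aleph0_lt_continuum
      · rwa [mk_finset_of_infinite]
    have h2 : #(ℕ × Bool) < 𝔠 := by simpa using aleph0_lt_continuum
    have h3 : #(Finset B × ℕ × Bool) < 𝔠 := by
      rw [mk_prod, lift_id, lift_id]
      exact mul_lt_of_lt aleph0_le_continuum h1 h2
    rw [mk_prod, lift_id, lift_id]
    exact mul_lt_of_lt aleph0_le_continuum h1 h3
  obtain ⟨x, hx, hxD, hxK⟩ := exists_mem_closure_avoiding hd hq r hι (K := K)
    (by
      intro i
      simp only [K, ofPred_forall]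
      exact isClosed_iInter fun m => isClosed_iInter fun _ => isClosed_iInter fun _ =>
        isClosed_eq (continuous_apply m) continuous_const)
    (by
      rintro ⟨F, G, b, c⟩
      refine (F.finite_toSet.image Subtype.val).subset ?_
      rintro y ⟨hy, hyK⟩
      by_contra hyF
      have hyF' : (⟨y, hqB hy⟩ : B) ∉ F := fun h => hyF ⟨_, h, rfl⟩
      obtain ⟨m, hm, hbm⟩ := (hB.infinite
        (F := (insert ⟨y, hqB hy⟩ F).map (Function.Embedding.subtype _))
        (by simp [insert_subset_iff, hqB hy])
        (fun z => if z = y then !c else decide (∃ h : z ∈ B, (⟨z, h⟩ : B) ∈ G))).exists_gt b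
      simp only [Finset.mem_map, Function.Embedding.subtype_apply, mem_ofPred_eq,
        forall_exists_index, and_imp, forall_apply_eq_imp_iff₂] at hm
      have h1 := hm _ (Finset.mem_insert_self _ _)
      have h2 : m ∈ S F G := fun z hz => by
        have h3 := hm z (Finset.mem_insert_of_mem hz)
        have h4 : z.1 ≠ y := fun h => hyF' (by subst h; exact hz)
        simpa [h4] using h3
      have h5 := hyK m h2 hbm.le
      simp [h5] at h1)
  refine ⟨x, hx, hxD, fun F hF _ ν => ?_⟩
  rw [← Nat.frequently_atTop_iff_infinite, Filter.frequently_atTop]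
  intro b
  let F' : Finset B := (F.erase x).subtype (· ∈ B)
  have := hxK (F', F'.filter fun y => ν y.1, b, !ν x)
  simp only [K, mem_ofPred_eq, not_forall] at this
  obtain ⟨m, hmS, hbm, hm⟩ := this
  refine ⟨m, hbm, fun y hy => ?_⟩
  by_cases hyx : y = x
  · subst hyx
    simpa using hm
  · have hyB : y ∈ B := (hF hy).resolve_left hyx
    have hyF : (⟨y, hyB⟩ : B) ∈ F' := by simp [F', hyx, hy]
    have := hmS _ hyF
    simpa [Finset.mem_filter, hyF] using this

theorem exists_countable_dense_indepFamily :
    ∃ A : Set (ℕ → Bool), A.Countable ∧ Dense A ∧ IndepFamily A := by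
  classical
  let y (s : List Bool) (m : ℕ) : Bool :=
    if h : m < s.length then s[m] else m.testBit (Encodable.encode s)
  refine ⟨range y, countable_range y, fun x => ?_, fun F hF _ ν => ?_⟩
  · rw [mem_closure_iff]
    intro U hU hxU
    obtain ⟨n, hn⟩ := exists_cylinder_subset hU hxU
    refine ⟨_, hn fun m hm => ?_, mem_range_self (List.ofFn fun i : Fin n => x i)⟩
    simp [y, hm]
  · have hs : ∀ x, ∃ s, x ∈ F → y s = x := fun x => by
      by_cases h : x ∈ F
      · exact (hF h).imp fun s hs _ => hs
      · exact ⟨[], fun h' => absurd h' h⟩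
    choose s hs using hs
    refine infinite_of_not_bddAbove ?_
    rintro ⟨b, hb⟩
    obtain ⟨l, hl⟩ : ∃ l, ∀ x ∈ F, Encodable.encode (s x) < l ∧ (s x).length ≤ l ∧ b ≤ l := by
      refine ⟨F.sup (fun x => Encodable.encode (s x) + 1 + (s x).length) + b, fun x hx => ?_⟩
      have := Finset.le_sup (f := fun x => Encodable.encode (s x) + 1 + (s x).length) hx
      omega
    let f (i : Fin (max l b + 1)) : Bool :=
      i.1 = max l b ∨ ∃ x ∈ F, Encodable.encode (s x) = i ∧ ν x
    have hlt : max l b < Nat.ofBits f := by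
      refine Nat.lt_two_pow_self.trans_le (Nat.ge_two_pow_of_testBit ?_)
      rw [Nat.testBit_ofBits_lt f _ (Nat.lt_succ_self _)]
      simp [f]
    refine absurd (hb fun x hx => ?_) (not_le.2 ((le_max_right l b).trans_lt hlt))
    obtain ⟨h1, h2, h3⟩ := hl x hx
    conv_lhs => rw [← hs x hx]
    have h4 : ¬ Nat.ofBits f < (s x).length := by omega
    simp only [y, h4, dite_false]
    rw [Nat.testBit_ofBits_lt f _ (by omega)]
    have h5 : Encodable.encode (s x) ≠ max l b := by omega
    have h6 : (∃ z ∈ F, Encodable.encode (s z) = Encodable.encode (s x) ∧ ν z = true) ↔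
        ν x = true := by
      refine ⟨?_, fun h => ⟨x, hx, rfl, h⟩⟩
      rintro ⟨z, hz, hzx, hν⟩
      rw [← hs x hx, ← Encodable.encode_injective hzx, hs z hz, hν]
    simp only [f, h5, h6, false_or, Bool.decide_eq_true]

/-- A subset of the Cantor space is completely Baire if it contains enough limits of its recurrent
sequences. -/
theorem baireSpace_of_recurrent {A : Set (ℕ → Bool)}
    (hA : ∀ (q : ℕ → ℕ → Bool) (D : ℕ → Set ℕ) (r : ℕ → ℕ → ℕ), Recurrent q D →
      range q ⊆ A → ∃ x ∈ A, x ∈ closure (range q) ∧ ∀ k, ∃ n ∈ D k, x ∈ cylinder (q n) (r k n))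
    {C : Set A} (hC : IsClosed C) : BaireSpace C := by
  let v : C → ℕ → Bool := fun c => c.1.1
  have hv : Topology.IsEmbedding v :=
    Topology.IsEmbedding.subtypeVal.comp Topology.IsEmbedding.subtypeVal
  refine ⟨fun U hUo hUd => ?_⟩
  by_contra hnd
  obtain ⟨W, hWo, hWne, hW⟩ : ∃ W : Set C, IsOpen W ∧ W.Nonempty ∧ ∀ x ∈ W, x ∉ ⋂ n, U n := by
    simp only [dense_iff_inter_open, not_forall] at hnd
    obtain ⟨W, hWo, hWne, hW⟩ := hnd
    exact ⟨W, hWo, hWne, fun x hxW hxU => hW ⟨x, hxW, hxU⟩⟩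
  have hinf : ∀ V ⊆ W, IsOpen V → V.Nonempty → V.Infinite := by
    rintro V hVW hVo ⟨x, hxV⟩ hfin
    have hx : IsOpen {x} := by
      have : {x} = V \ (V \ {x}) := by
        ext z
        by_cases h : z = x <;> simp [h, hxV]
      rw [this]
      exact hVo.sdiff hfin.sdiff.isClosed
    refine hW x (hVW hxV) (mem_iInter.2 fun n => ?_)
    obtain ⟨z, hzx, hz⟩ := (hUd n).inter_open_nonempty _ hx (singleton_nonempty x)
    rwa [← mem_singleton_iff.1 hzx]
  obtain ⟨Q, hQc, hQd⟩ := TopologicalSpace.exists_countable_dense C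
  obtain ⟨q, hq⟩ := (hQc.mono (inter_subset_right (s := W))).exists_eq_range
    (hQd.inter_open_nonempty W hWo hWne)
  have hqW : ∀ n, q n ∈ W := fun n => (hq ▸ mem_range_self n : q n ∈ W ∩ Q).1
  have hO : ∀ k, ∃ O, IsOpen O ∧ v ⁻¹' O = W ∩ U k := fun k =>
    hv.isInducing.isOpen_iff.1 (hWo.inter (hUo k))
  choose O hOo hO using hO
  have hr : ∀ k n, ∃ r, q n ∈ U k → cylinder (v (q n)) r ⊆ O k := fun k n => by
    by_cases h : q n ∈ U k
    · have : q n ∈ v ⁻¹' O k := hO k ▸ ⟨hqW n, h⟩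
      exact (exists_cylinder_subset (hOo k) this).imp fun r hr _ => hr
    · exact ⟨0, fun h' => absurd h' h⟩
  choose r hr using hr
  obtain ⟨x, hxA, hxcl, hx⟩ := hA (fun n => v (q n)) (fun k => {n | q n ∈ U k}) r
    (by
      intro k n M
      have hVo : IsOpen (W ∩ v ⁻¹' cylinder (v (q n)) M) :=
        hWo.inter ((isOpen_cylinder _ _ _).preimage hv.continuous)
      have hVne : (W ∩ v ⁻¹' cylinder (v (q n)) M ∩ U k).Nonempty :=
        (hUd k).inter_open_nonempty _ hVo ⟨q n, hqW n, self_mem_cylinder _ _⟩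
      have hVinf := hinf _ (fun z hz => hz.1.1) (hVo.inter (hUo k)) hVne
      have hfin : (q '' Iic n).Finite := (finite_Iic n).image q
      obtain ⟨z, ⟨⟨⟨hzW, hzc⟩, hzU⟩, hzn⟩, hzQ⟩ := hQd.inter_open_nonempty _
        ((hVo.inter (hUo k)).sdiff hfin.isClosed) (hVinf.sdiff hfin).nonempty
      obtain ⟨n', rfl⟩ : z ∈ range q := hq ▸ ⟨hzW, hzQ⟩
      exact ⟨n', hzU, hzc, fun j hj h => hzn ⟨j, hj, (hv.injective h).symm⟩⟩)
    (by rintro _ ⟨n, rfl⟩; exact (q n).1.2)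
  have hxC : (⟨x, hxA⟩ : A) ∈ C := by
    rw [← hC.closure_eq, closure_subtype]
    refine closure_mono ?_ hxcl
    rintro _ ⟨n, rfl⟩
    exact ⟨(q n).1, (q n).2, rfl⟩
  have hxO : ∀ k, (⟨⟨x, hxA⟩, hxC⟩ : C) ∈ W ∩ U k := fun k => by
    obtain ⟨n, hn, hxn⟩ := hx k
    exact hO k ▸ hr k n hn hxn
  exact hW _ (hxO 0).1 (mem_iInter.2 fun k => (hxO k).2)

theorem exists_greedy {J X : Type*} [Preorder J] [WellFoundedLT J] {P : J → Set X → X → Prop}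
    (hP : ∀ j S, ∃ x, P j S x) : ∃ a : J → X, ∀ j, P j (a '' Iio j) (a j) := by
  choose c hc using hP
  let a : J → X := WellFoundedLT.fix fun j (f : ∀ i, i < j → X) =>
    c j {x | ∃ i, ∃ h : i < j, f i h = x}
  have ha : ∀ j, a j = c j (a '' Iio j) := fun j => by
    refine (WellFoundedLT.fix_eq _ j).trans (congrArg (c j) ?_)
    ext x
    simp [a]
  exact ⟨a, fun j => by rw [ha j]; exact hc _ _⟩

theorem exists_dense_completely_baire_independent (hd : dNumber = Cardinal.continuum) :
    ∃ A : Set (ℕ → Bool), IndepFamily A ∧ Dense A ∧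
      ∀ C : Set ↥A, IsClosed C → BaireSpace ↥C := by
  classical
  obtain ⟨A₀, hA₀c, hA₀d, hA₀⟩ := exists_countable_dense_indepFamily
  obtain ⟨x₀, hx₀⟩ := hA₀d.nonempty
  let I := (ℕ → ℕ → Bool) × (ℕ → ℕ → Bool) × (ℕ → ℕ → ℕ)
  let J := (𝔠 : Cardinal.{0}).ord.ToType
  have hI : #I = #J := by
    simp [I, J]
  obtain ⟨e⟩ : Nonempty (J ≃ I) := Cardinal.eq.1 hI.symm
  let good (j : J) (S : Set (ℕ → Bool)) (x : ℕ → Bool) : Prop :=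
    x ∈ closure (range (e j).1) ∧
      (∀ k, ∃ n ∈ {n | (e j).2.1 k n}, x ∈ cylinder ((e j).1 n) ((e j).2.2 k n)) ∧
      IndepFamily (insert x (A₀ ∪ S ∪ range (e j).1))
  obtain ⟨a, ha⟩ := exists_greedy (J := J)
    (P := fun j S x => good j S x ∨ x = x₀ ∧ ¬ ∃ y, good j S y) fun j S => by
      by_cases h : ∃ y, good j S y
      · exact h.imp fun y hy => Or.inl hy
      · exact ⟨x₀, Or.inr ⟨rfl, h⟩⟩
  have hfin : ∀ E : Finset J, IndepFamily (A₀ ∪ a '' E) := by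
    intro E
    induction E using Finset.induction_on_max with
    | empty => simpa using hA₀
    | insert j E hE ih =>
      rcases ha j with ⟨-, -, h⟩ | ⟨h, -⟩
      · refine h.mono ?_
        rintro y (hy | ⟨i, hi, rfl⟩)
        · exact Or.inr (Or.inl (Or.inl hy))
        · rcases Finset.mem_insert.1 hi with rfl | hi
          · exact Or.inl rfl
          · exact Or.inr (Or.inl (Or.inr ⟨i, hE i hi, rfl⟩))
      · refine ih.mono ?_
        rintro y (hy | ⟨i, hi, rfl⟩)
        · exact Or.inl hy
        · rcases Finset.mem_insert.1 hi with rfl | hi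
          · exact Or.inl (h ▸ hx₀)
          · exact Or.inr ⟨i, hi, rfl⟩
  have hA : IndepFamily (A₀ ∪ range a) := fun F hF hne ν => by
    have hj : ∀ x, ∃ E : Finset J, x ∈ F → x ∈ A₀ ∪ a '' E := fun x => by
      by_cases hx : x ∈ F
      · rcases hF hx with h | ⟨i, rfl⟩
        · exact ⟨∅, fun _ => Or.inl h⟩
        · exact ⟨{i}, fun _ => Or.inr ⟨i, by simp, rfl⟩⟩
      · exact ⟨∅, fun h => absurd h hx⟩
    choose E hE using hj
    refine hfin (F.biUnion E) F (fun x hx => ?_) hne ν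
    refine (hE x hx).imp_right fun h => image_mono ?_ h
    exact_mod_cast Finset.subset_biUnion_of_mem E hx
  refine ⟨A₀ ∪ range a, hA, hA₀d.mono subset_union_left, fun C hC =>
    baireSpace_of_recurrent (fun q D r hq hqA => ?_) hC⟩
  obtain ⟨j, hj⟩ := e.surjective (q, fun k n => decide (n ∈ D k), r)
  have hB : IndepFamily (A₀ ∪ a '' Iio j ∪ range q) :=
    hA.mono (union_subset (union_subset_union_right _ (image_subset_range _ _)) hqA)
  have hcard : #(A₀ ∪ a '' Iio j ∪ range q : Set (ℕ → Bool)) < 𝔠 := by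
    have h1 : #A₀ < 𝔠 := hA₀c.le_aleph0.trans_lt aleph0_lt_continuum
    have h2 : #(a '' Iio j) < 𝔠 := by
      simpa [J] using mk_image_le.trans_lt (mk_Iio_lt j (by simp [J]))
    have h3 : #(range q) < 𝔠 := (countable_range q).le_aleph0.trans_lt aleph0_lt_continuum
    exact (mk_union_le _ _).trans_lt (add_lt_of_lt aleph0_le_continuum
      ((mk_union_le _ _).trans_lt (add_lt_of_lt aleph0_le_continuum h1 h2)) h3)
  have hgood : ∃ y, good j (a '' Iio j) y := by
    obtain ⟨x, h1, h2, h3⟩ := hB.exists_insert hd hcard hq r subset_union_right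
    exact ⟨x, by simpa [good, hj] using ⟨h1, h2, h3⟩⟩
  have haj := (ha j).resolve_right fun h => h.2 hgood
  simp only [good, hj] at haj
  exact ⟨a j, Or.inr (mem_range_self j), haj.1, by simpa using haj.2.1⟩
end

section
/- Let X be a Polish space (not necessarily crowded) and 𝓡 a countable collection of meager relations on X. Then there exists F ⊆ X such that F is dense in X, F is Baire, and F is R-free for every R ∈ 𝓡. -/
open Set Filter Topology

/-- Inside finitely many members of a π-base, indexed by `f`, one can find smaller members such
that prescribed products of distinct members avoid a nowhere dense set. -/
lemma exists_refinement_avoiding_one {X J : Type*} [TopologicalSpace X]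
    {U : ℕ → Set X} (hUo : ∀ q, IsOpen (U q)) (hUn : ∀ q, (U q).Nonempty)
    (hU : ∀ V : Set X, IsOpen V → V.Nonempty → ∃ q, U q ⊆ V)
    (f : J → ℕ) {n : ℕ} {g : Fin n → J} (hg : Function.Injective g)
    {N : Set (Fin n → X)} (hN : IsNowhereDense N) :
    ∃ f' : J → ℕ, (∀ a, U (f' a) ⊆ U (f a)) ∧
      ∀ x : Fin n → X, (∀ i, x i ∈ U (f' (g i))) → x ∉ N := by
  classical
  have hbox : IsOpen (univ.pi fun i => U (f (g i))) :=
    isOpen_set_pi finite_univ fun i _ => hUo _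
  have hne : (univ.pi fun i => U (f (g i))).Nonempty :=
    univ_pi_nonempty_iff.2 fun i => hUn _
  have hdense : Dense (closure N)ᶜ := interior_eq_empty_iff_dense_compl.1 hN
  obtain ⟨y, hyU, hyN⟩ := hdense.inter_open_nonempty _ hbox hne
  have hopen : IsOpen ((univ.pi fun i => U (f (g i))) ∩ (closure N)ᶜ) :=
    hbox.inter isClosed_closure.isOpen_compl
  obtain ⟨u, hu, hsub⟩ := isOpen_pi_iff'.1 hopen y ⟨hyU, hyN⟩
  have hsmall : ∀ i, ∃ q, U q ⊆ u i ∩ U (f (g i)) := fun i =>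
    hU _ ((hu i).1.inter (hUo _)) ⟨y i, (hu i).2, hyU i trivial⟩
  choose q hq using hsmall
  refine ⟨fun a => if h : ∃ i, g i = a then q h.choose else f a, fun a => ?_, fun x hx hxN => ?_⟩
  · dsimp only
    split_ifs with h
    · have := h.choose_spec
      exact (hq _).trans (inter_subset_right.trans (by rw [this]))
    · exact Subset.rfl
  · have hxu : x ∈ univ.pi u := fun i _ => by
      have h : ∃ i', g i' = g i := ⟨i, rfl⟩
      have hi := hx i
      dsimp only at hi
      rw [dif_pos h, hg h.choose_spec] at hi
      exact (hq i hi).1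
    exact (hsub hxu).2 (subset_closure hxN)

lemma exists_refinement_avoiding {X J : Type*} [TopologicalSpace X]
    {U : ℕ → Set X} (hUo : ∀ q, IsOpen (U q)) (hUn : ∀ q, (U q).Nonempty)
    (hU : ∀ V : Set X, IsOpen V → V.Nonempty → ∃ q, U q ⊆ V)
    (N : ℕ → Σ n, Set (Fin n → X)) (hN : ∀ l, IsNowhereDense (N l).2)
    (f : J → ℕ) (S : Finset (Σ l, Fin (N l).1 → J)) :
    ∃ f' : J → ℕ, (∀ a, U (f' a) ⊆ U (f a)) ∧
      ∀ r ∈ S, Function.Injective r.2 →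
        ∀ x : Fin (N r.1).1 → X, (∀ i, x i ∈ U (f' (r.2 i))) → x ∉ (N r.1).2 := by
  classical
  induction S using Finset.induction_on with
  | empty => exact ⟨f, fun _ => Subset.rfl, by simp⟩
  | insert r S _ ih =>
    obtain ⟨f₁, h₁, h₁'⟩ := ih
    by_cases hr : Function.Injective r.2
    · obtain ⟨f₂, h₂, h₂'⟩ := exists_refinement_avoiding_one hUo hUn hU f₁ hr (hN r.1)
      refine ⟨f₂, fun a => (h₂ a).trans (h₁ a), fun s hs hinj x hx => ?_⟩
      rcases Finset.mem_insert.1 hs with rfl | hs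
      · exact h₂' x hx
      · exact h₁' s hs hinj x fun i => h₂ _ (hx i)
    · refine ⟨f₁, h₁, fun s hs hinj x hx => ?_⟩
      rcases Finset.mem_insert.1 hs with rfl | hs
      · exact absurd hinj hr
      · exact h₁' s hs hinj x hx

/-- A fusion scheme: finite stages `P k` of indices and refinements `e k p t` of `U p`, labelled
by `t ⊆ {0, …, k - 1}`, such that differently labelled refinements at stage `k` avoid `N l` for
`l < k`. -/
lemma exists_fusion_scheme {X : Type*} [TopologicalSpace X]
    {U : ℕ → Set X} (hUo : ∀ q, IsOpen (U q)) (hUn : ∀ q, (U q).Nonempty)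
    (hU : ∀ V : Set X, IsOpen V → V.Nonempty → ∃ q, U q ⊆ V)
    (N : ℕ → Σ n, Set (Fin n → X)) (hN : ∀ l, IsNowhereDense (N l).2) :
    ∃ (P : ℕ → Finset ℕ) (e : ℕ → ℕ → Finset ℕ → ℕ),
      Monotone P ∧ (∀ q, ∃ k, q ∈ P k) ∧
      (∀ k, ∀ p ∈ P k, ∀ t ∈ (Finset.range k).powerset, e k p t ∈ P (k + 1)) ∧
      (∀ k p t, U (e k p t) ⊆ U p) ∧
      ∀ k, ∀ l < k, ∀ (p : Fin (N l).1 → ℕ) (t : Fin (N l).1 → Finset ℕ),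
        (∀ i, p i ∈ P k) → (∀ i, t i ∈ (Finset.range k).powerset) → Function.Injective t →
        ∀ x : Fin (N l).1 → X, (∀ i, x i ∈ U (e k (p i) (t i))) → x ∉ (N l).2 := by
  classical
  have hstep := fun (k : ℕ) (Q : Finset ℕ) =>
    exists_refinement_avoiding hUo hUn hU N hN (fun a : ℕ × Finset ℕ => a.1)
      ((Finset.range k).sigma fun l =>
        Fintype.piFinset fun _ : Fin (N l).1 => Q ×ˢ (Finset.range k).powerset)
  choose E hE hE' using hstep
  let P : ℕ → Finset ℕ := fun k => Nat.rec ∅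
    (fun k Q => insert k (Q ∪ (Q ×ˢ (Finset.range k).powerset).image (E k Q))) k
  have hP : ∀ k, P (k + 1) =
      insert k (P k ∪ (P k ×ˢ (Finset.range k).powerset).image (E k (P k))) := fun k => rfl
  refine ⟨P, fun k p t => E k (P k) (p, t), monotone_nat_of_le_succ fun k => ?_,
    fun q => ⟨q + 1, ?_⟩, fun k p hp t ht => ?_, fun k p t => hE k (P k) (p, t),
    fun k l hl p t hp ht hinj x hx => ?_⟩
  · rw [hP]
    exact fun a ha => Finset.mem_insert_of_mem (Finset.mem_union_left _ ha)
  · rw [hP]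
    exact Finset.mem_insert_self _ _
  · rw [hP]
    exact Finset.mem_insert_of_mem (Finset.mem_union_right _
      (Finset.mem_image_of_mem _ (Finset.mk_mem_product hp ht)))
  · refine hE' k (P k) ⟨l, fun i => (p i, t i)⟩ ?_ (fun i j hij => hinj (Prod.ext_iff.1 hij).2) x hx
    refine Finset.mem_sigma.2 ⟨Finset.mem_range.2 hl, Fintype.mem_piFinset.2 fun i => ?_⟩
    exact Finset.mk_mem_product (hp i) (ht i)

/-- A nonprincipal ultrafilter contains every other block of some interval partition whose
consecutive endpoints satisfy a prescribed relation. -/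
lemma exists_alternating_blocks (𝒰 : Ultrafilter ℕ) (h𝒰 : (𝒰 : Filter ℕ) ≤ atTop)
    (S : ℕ → ℕ → ℕ → Prop) (hS : ∀ n a b, S (n + 1) a b → S n a b)
    (hex : ∀ n a, ∃ b, a < b ∧ S n a b) (k₀ : ℕ) :
    ∃ j : ℕ → ℕ, StrictMono j ∧ k₀ ≤ j 0 ∧ (∀ n, S n (j n) (j (n + 1))) ∧
      (⋃ n, Ico (j (2 * n + 1)) (j (2 * n + 2))) ∈ 𝒰 := by
  choose b hb hbS using hex
  let j : ℕ → ℕ := fun n => Nat.rec k₀ b n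
  have hj : StrictMono j := strictMono_nat_of_lt_succ fun n => hb n (j n)
  have hjS : ∀ n, S n (j n) (j (n + 1)) := fun n => hbS n (j n)
  have hcover : Ici (j 1) ⊆ (⋃ n, Ico (j (2 * n + 1)) (j (2 * n + 2))) ∪
      ⋃ n, Ico (j (2 * n + 2)) (j (2 * n + 3)) := by
    intro k hk
    have hex : ∃ n, k < j (n + 1) :=
      ⟨k, (Nat.lt_succ_self k).trans_le (hj.id_le (k + 1))⟩
    classical
    have hlt := Nat.find_spec hex
    have hmin := fun m => Nat.find_min (H := hex) (m := m)
    generalize Nat.find hex = n at hlt hmin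
    rcases n with _ | n
    · exact absurd hlt (not_lt.2 hk)
    have hge : j (n + 1) ≤ k := not_lt.1 (hmin n (Nat.lt_succ_self n))
    rcases Nat.even_or_odd' n with ⟨m, rfl | rfl⟩
    · exact Or.inl (mem_iUnion.2 ⟨m, hge, hlt⟩)
    · exact Or.inr (mem_iUnion.2 ⟨m, hge, hlt⟩)
  rcases Ultrafilter.union_mem_iff.1 (mem_of_superset (h𝒰 (Ici_mem_atTop (j 1))) hcover) with h | h
  · exact ⟨j, hj, le_rfl, hjS, h⟩
  · exact ⟨fun n => j (n + 1), fun a b hab => hj (Nat.succ_lt_succ hab), hj.monotone (Nat.zero_le 1),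
      fun n => hS _ _ _ (hjS (n + 1)), h⟩

lemma exists_refinement_along_block {X : Type*} {U : ℕ → Set X} {P : ℕ → Finset ℕ}
    {e : ℕ → ℕ → ℕ} (he : ∀ k, ∀ p ∈ P k, e k p ∈ P (k + 1))
    (heU : ∀ k p, U (e k p) ⊆ U p) {a b : ℕ} (hab : a ≤ b) {p : ℕ} (hp : p ∈ P a) :
    ∃ q ∈ P b, U q ⊆ U p ∧ ∀ k ∈ Ico a b, ∃ r ∈ P k, U q ⊆ U (e k r) := by
  induction b, hab using Nat.le_induction with
  | base => exact ⟨p, hp, Subset.rfl, by simp⟩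
  | succ b hab ih =>
    obtain ⟨q, hq, hqp, hk⟩ := ih
    refine ⟨e b q, he b q hq, (heU b q).trans hqp, fun k hkab => ?_⟩
    rcases (Nat.lt_succ_iff.1 hkab.2).eq_or_lt with rfl | hlt
    · exact ⟨q, hq, Subset.rfl⟩
    · obtain ⟨r, hr, hqr⟩ := hk k ⟨hkab.1, hlt⟩
      exact ⟨r, hr, (heU b q).trans hqr⟩

/-- A decreasing sequence of small nonempty sets, each containing the closure of the next, has a
common point in a complete space. -/
lemma exists_mem_forall_of_closure_subset {X : Type*} [MetricSpace X] [CompleteSpace X]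
    {V : ℕ → Set X} (hne : ∀ n, (V n).Nonempty) (hcl : ∀ n, closure (V (n + 1)) ⊆ V n)
    (hball : ∀ n : ℕ, ∃ y, V (n + 1) ⊆ Metric.ball y (1 / ((n : ℝ) + 1))) :
    ∃ x, ∀ n, x ∈ V n := by
  have hanti : Antitone V := antitone_nat_of_succ_le fun n => subset_closure.trans (hcl n)
  choose z hz using hne
  have hzero : Tendsto (fun n : ℕ => 2 * (1 / ((n : ℝ) + 1))) atTop (𝓝 0) := by
    simpa using tendsto_one_div_add_atTop_nhds_zero_nat.const_mul (2 : ℝ)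
  have hcauchy : CauchySeq fun n => z (n + 1) := by
    refine cauchySeq_of_le_tendsto_0 _ (fun m m' n hm hm' => ?_) hzero
    obtain ⟨y, hy⟩ := hball n
    have h₁ := Metric.mem_ball.1 (hy (hanti (Nat.succ_le_succ hm) (hz (m + 1))))
    have h₂ := Metric.mem_ball.1 (hy (hanti (Nat.succ_le_succ hm') (hz (m' + 1))))
    linarith [dist_triangle_right (z (m + 1)) (z (m' + 1)) y]
  obtain ⟨x, hx⟩ := cauchySeq_tendsto_of_complete hcauchy
  refine ⟨x, fun n => hcl n (mem_closure_of_tendsto hx ?_)⟩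
  filter_upwards [eventually_ge_atTop n] with m hm
  exact hanti (Nat.succ_le_succ hm) (hz (m + 1))

/-- A point of the dense `G_δ` set `⋂ n, D n` which follows the refinements `e` at almost all
stages with respect to a nonprincipal ultrafilter. -/
lemma exists_generic_point {X : Type*} [MetricSpace X] [CompleteSpace X]
    {U : ℕ → Set X} (hUo : ∀ q, IsOpen (U q)) (hUn : ∀ q, (U q).Nonempty)
    (hU : ∀ V : Set X, IsOpen V → V.Nonempty → ∃ q, U q ⊆ V)
    {P : ℕ → Finset ℕ} (hPmono : Monotone P) (hPex : ∀ q, ∃ k, q ∈ P k)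
    {e : ℕ → ℕ → ℕ} (he : ∀ k, ∀ p ∈ P k, e k p ∈ P (k + 1))
    (heU : ∀ k p, U (e k p) ⊆ U p)
    (𝒰 : Ultrafilter ℕ) (h𝒰 : (𝒰 : Filter ℕ) ≤ atTop)
    {V : Set X} (hV : IsOpen V) (hVn : V.Nonempty)
    {D : ℕ → Set X} (hDo : ∀ n, IsOpen (D n)) (hD : ∀ n, Dense (D n)) :
    ∃ x ∈ V, (∀ n, x ∈ D n) ∧ ∀ᶠ k in (𝒰 : Filter ℕ), ∃ p ∈ P k, x ∈ U (e k p) := by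
  let W : ℕ → Set X := fun n => ⋂ m ∈ Iic n, D m
  have hWo : ∀ n, IsOpen (W n) := fun n => (finite_Iic n).isOpen_biInter fun m _ => hDo m
  have hW : ∀ n, Dense (W n) := fun n =>
    dense_biInter_of_isOpen (fun m _ => hDo m) (to_countable _) fun m _ => hD m
  have hWanti : Antitone W := fun m n hmn => biInter_mono (Iic_subset_Iic.2 hmn) fun _ _ => Subset.rfl
  let G : ℕ → ℕ → ℕ → Prop := fun n p q =>
    closure (U q) ⊆ U p ∩ W n ∧ ∃ y, U q ⊆ Metric.ball y (1 / ((n : ℝ) + 1))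
  have hGanti : ∀ {m n p q}, m ≤ n → G n p q → G m p q := by
    rintro m n p q hmn ⟨h, y, hy⟩
    refine ⟨h.trans (inter_subset_inter_right _ (hWanti hmn)), y,
      hy.trans (Metric.ball_subset_ball ?_)⟩
    exact one_div_le_one_div_of_le (by positivity) (by gcongr)
  have hGex : ∀ n p, ∃ q, G n p q := by
    intro n p
    obtain ⟨y, hy⟩ := (hW n).inter_open_nonempty _ (hUo p) (hUn p)
    obtain ⟨ε, hε, hsub⟩ := Metric.isOpen_iff.1 ((hUo p).inter (hWo n)) y hy
    have hδ : 0 < min (ε / 2) (1 / ((n : ℝ) + 1)) := by positivity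
    obtain ⟨q, hq⟩ := hU _ Metric.isOpen_ball ⟨y, Metric.mem_ball_self hδ⟩
    refine ⟨q, ?_, y, hq.trans (Metric.ball_subset_ball (min_le_right _ _))⟩
    refine (closure_mono hq).trans (Metric.closure_ball_subset_closedBall.trans ?_)
    refine (Metric.closedBall_subset_ball ?_).trans hsub
    exact (min_le_left _ _).trans_lt (half_lt_self hε)
  obtain ⟨p₀, hp₀⟩ := hU V hV hVn
  obtain ⟨k₀, hk₀⟩ := hPex p₀
  obtain ⟨j, hj, hjk, hjS, hjmem⟩ := exists_alternating_blocks 𝒰 h𝒰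
    (fun n a b => ∀ p ∈ P a, ∃ q ∈ P b, G n p q)
    (fun n a b h p hp => (h p hp).imp fun q hq => ⟨hq.1, hGanti n.le_succ hq.2⟩)
    (fun n a => by
      choose q hq using hGex n
      choose κ hκ using hPex
      refine ⟨max (a + 1) ((P a).sup fun p => κ (q p)), by grind, fun p hp => ⟨q p, ?_, hq p⟩⟩
      exact hPmono (le_max_of_le_right (Finset.le_sup (f := fun p => κ (q p)) hp)) (hκ (q p)))
    k₀
  have hnext : ∀ n, ∀ p : P (j (2 * n)), ∃ q : P (j (2 * (n + 1))), G n p q ∧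
      ∀ k ∈ Ico (j (2 * n + 1)) (j (2 * n + 2)), ∃ r ∈ P k, U q ⊆ U (e k r) := by
    intro n p
    obtain ⟨q, hq, hpq⟩ := hjS (2 * n) p p.2
    obtain ⟨q', hq', hqq', hrun⟩ := exists_refinement_along_block he heU
      (hj (Nat.lt_succ_self (2 * n + 1))).le hq
    obtain ⟨hcl, y, hy⟩ := hGanti (by omega : n ≤ 2 * n) hpq
    exact ⟨⟨q', hq'⟩, ⟨(closure_mono hqq').trans hcl, y, hqq'.trans hy⟩, hrun⟩
  choose s hs hsrun using hnext
  let p : ∀ n, P (j (2 * n)) := fun n =>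
    Nat.rec (motive := fun n => P (j (2 * n))) ⟨p₀, hPmono hjk hk₀⟩ s n
  have hpG : ∀ n, G n (p n) (p (n + 1)) := fun n => hs n (p n)
  obtain ⟨x, hx⟩ := exists_mem_forall_of_closure_subset (V := fun n => U (p n))
    (fun n => hUn _) (fun n => (hpG n).1.trans inter_subset_left) fun n => (hpG n).2
  refine ⟨x, hp₀ (hx 0), fun n => ?_, mem_of_superset hjmem fun k hk => ?_⟩
  · exact mem_iInter₂.1 ((hpG n).1 (subset_closure (hx (n + 1)))).2 n (mem_Iic.2 le_rfl)
  · obtain ⟨n, hn⟩ := mem_iUnion.1 hk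
    obtain ⟨r, hr, hsub⟩ := hsrun n (p n) k hn
    exact ⟨r, hr, hsub (hx (n + 1))⟩

lemma dense_and_baireSpace_of_forall_inter_nonempty {X : Type*} [TopologicalSpace X] {F : Set X}
    (hF : ∀ V : Set X, IsOpen V → V.Nonempty → ∀ D : ℕ → Set X, (∀ n, IsOpen (D n)) →
      (∀ n, Dense (D n)) → ∃ x ∈ F, x ∈ V ∧ ∀ n, x ∈ D n) :
    Dense F ∧ BaireSpace F := by
  have hdense : Dense F := dense_iff_inter_open.2 fun V hV hVn => by
    obtain ⟨x, hxF, hxV, -⟩ := hF V hV hVn (fun _ => univ) (fun _ => isOpen_univ)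
      fun _ => dense_univ
    exact ⟨x, hxV, hxF⟩
  refine ⟨hdense, ⟨fun f hfo hfd => ?_⟩⟩
  choose D hDo hDf using fun n => isOpen_induced_iff.1 (hfo n)
  have hD : ∀ n, Dense (D n) := fun n => dense_iff_inter_open.2 fun V hV hVn => by
    obtain ⟨y, hyV, hyF⟩ := hdense.inter_open_nonempty V hV hVn
    obtain ⟨z, hzV, hzf⟩ := (hfd n).inter_open_nonempty _ (hV.preimage continuous_subtype_val)
      ⟨⟨y, hyF⟩, hyV⟩
    rw [← hDf n] at hzf
    exact ⟨z, hzV, hzf⟩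
  refine dense_iff_inter_open.2 fun O hO hOn => ?_
  obtain ⟨V, hV, rfl⟩ := isOpen_induced_iff.1 hO
  obtain ⟨y, hy⟩ := hOn
  obtain ⟨x, hxF, hxV, hxD⟩ := hF V hV ⟨y, hy⟩ D hDo hD
  refine ⟨⟨x, hxF⟩, hxV, mem_iInter.2 fun n => ?_⟩
  rw [← hDf n]
  exact hxD n

lemma exists_seq_piBase (X : Type*) [TopologicalSpace X] [SecondCountableTopology X] [Nonempty X] :
    ∃ U : ℕ → Set X, (∀ q, IsOpen (U q)) ∧ (∀ q, (U q).Nonempty) ∧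
      ∀ V : Set X, IsOpen V → V.Nonempty → ∃ q, U q ⊆ V := by
  obtain ⟨B, hBc, hBe, hB⟩ := TopologicalSpace.exists_countable_basis X
  have hsub : ∀ V : Set X, IsOpen V → V.Nonempty → ∃ u ∈ B, u ⊆ V := fun V hV ⟨x, hx⟩ => by
    obtain ⟨u, hu, -, huV⟩ := hB.exists_subset_of_mem_open hx hV
    exact ⟨u, hu, huV⟩
  obtain ⟨u, hu, -⟩ := hsub univ isOpen_univ univ_nonempty
  obtain ⟨U, rfl⟩ := hBc.exists_eq_range ⟨u, hu⟩
  refine ⟨U, fun q => hB.isOpen (mem_range_self q), fun q => ?_, fun V hV hVn => ?_⟩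
  · exact nonempty_iff_ne_empty.2 fun h => hBe (h ▸ mem_range_self q)
  · obtain ⟨_, ⟨q, rfl⟩, hq⟩ := hsub V hV hVn
    exact ⟨q, hq⟩

lemma eventually_injective_filter_range {n : ℕ} {α : Fin n → Set ℕ} (hα : Function.Injective α)
    [∀ i, DecidablePred (· ∈ α i)] :
    ∀ᶠ k in atTop, Function.Injective fun i => (Finset.range k).filter (· ∈ α i) := by
  have hpair : ∀ i i', i ≠ i' → ∃ m, ¬(m ∈ α i ↔ m ∈ α i') := fun i i' hii' => by
    by_contra! h
    exact hii' (hα (Set.ext h))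
  have hev : ∀ i i', ∀ᶠ k in atTop, (Finset.range k).filter (· ∈ α i) =
      (Finset.range k).filter (· ∈ α i') → i = i' := fun i i' => by
    by_cases hii' : i = i'
    · exact Eventually.of_forall fun _ _ => hii'
    · obtain ⟨m, hm⟩ := hpair i i' hii'
      filter_upwards [eventually_gt_atTop m] with k hk heq
      have := Finset.ext_iff.1 heq m
      simp only [Finset.mem_filter, Finset.mem_range, hk, true_and] at this
      exact absurd this hm
  filter_upwards [eventually_all.2 fun i => eventually_all.2 (hev i)] with k hk i i' heq
  exact hk i i' heq

theorem exists_dense_baire_free_of_isNowhereDense {X : Type*} [TopologicalSpace X] [PolishSpace X]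
    [Nonempty X] (N : ℕ → Σ n, Set (Fin n → X)) (hN : ∀ l, IsNowhereDense (N l).2) :
    ∃ F : Set X, Dense F ∧ BaireSpace F ∧
      ∀ l (x : Fin (N l).1 → X), Function.Injective x → (∀ k, x k ∈ F) → x ∉ (N l).2 := by
  classical
  let := TopologicalSpace.upgradeIsCompletelyMetrizable X
  obtain ⟨U, hUo, hUn, hU⟩ := exists_seq_piBase X
  obtain ⟨P, e, hPmono, hPex, he, heU, hfree⟩ := exists_fusion_scheme hUo hUn hU N hN
  let 𝒰 : Ultrafilter ℕ := hyperfilter ℕ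
  have h𝒰 : (𝒰 : Filter ℕ) ≤ atTop := Nat.cofinite_eq_atTop ▸ hyperfilter_le_cofinite
  let O : Set ℕ → ℕ → Set X := fun α n => ⋃ q ∈ {q | Nat.pair n q ∈ α}, U q
  have hOo : ∀ α n, IsOpen (O α n) := fun α n => isOpen_biUnion fun q _ => hUo q
  let τ : Set ℕ → ℕ → Finset ℕ := fun α k => (Finset.range k).filter (· ∈ α)
  have hτ : ∀ α k, τ α k ∈ (Finset.range k).powerset := fun α k =>
    Finset.mem_powerset.2 (Finset.filter_subset _ _)
  have hpoint : ∀ α : Set ℕ, (O α 0).Nonempty ∧ (∀ n, Dense (O α (n + 1))) →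
      ∃ x ∈ O α 0, (∀ n, x ∈ O α (n + 1)) ∧
        ∀ᶠ k in (𝒰 : Filter ℕ), ∃ p ∈ P k, x ∈ U (e k p (τ α k)) := fun α hα =>
    exists_generic_point hUo hUn hU hPmono hPex (e := fun k p => e k p (τ α k))
      (fun k p hp => he k p hp _ (hτ α k)) (fun k p => heU k p _) 𝒰 h𝒰
      (hOo α 0) hα.1 (fun n => hOo α (n + 1)) hα.2
  choose x hx₀ hx hxe using hpoint
  let F : Set X := {y | ∃ α hα, x α hα = y}
  obtain ⟨hdense, hbaire⟩ : Dense F ∧ BaireSpace F := by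
    refine dense_and_baireSpace_of_forall_inter_nonempty fun V hV hVn D hDo hD => ?_
    let D' : ℕ → Set X := fun n => Nat.casesOn n V D
    let α : Set ℕ := {m | U m.unpair.2 ⊆ D' m.unpair.1}
    have hmem : ∀ n q, Nat.pair n q ∈ α ↔ U q ⊆ D' n := fun n q => by simp [α]
    have hsub : ∀ n, O α n ⊆ D' n := fun n => iUnion₂_subset fun q hq => (hmem n q).1 hq
    have hα : (O α 0).Nonempty ∧ ∀ n, Dense (O α (n + 1)) := by
      refine ⟨?_, fun n => dense_iff_inter_open.2 fun W hW hWn => ?_⟩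
      · obtain ⟨q, hq⟩ := hU V hV hVn
        obtain ⟨y, hy⟩ := hUn q
        exact ⟨y, mem_biUnion ((hmem 0 q).2 hq) hy⟩
      · obtain ⟨q, hq⟩ := hU _ (hW.inter (hDo n)) ((hD n).inter_open_nonempty W hW hWn)
        obtain ⟨y, hy⟩ := hUn q
        exact ⟨y, (hq hy).1,
          mem_biUnion ((hmem (n + 1) q).2 (hq.trans inter_subset_right)) hy⟩
    exact ⟨x α hα, ⟨α, hα, rfl⟩, hsub 0 (hx₀ α hα), fun n => hsub (n + 1) (hx α hα n)⟩
  refine ⟨F, hdense, hbaire, fun l y hy hyF => ?_⟩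
  choose α hα hαy using hyF
  have hαinj : Function.Injective α := fun i i' h => hy (by
    rw [← hαy i, ← hαy i']
    congr)
  have hev : ∀ᶠ k in (𝒰 : Filter ℕ), (l < k ∧ Function.Injective fun i => τ (α i) k) ∧
      ∀ i, ∃ p ∈ P k, y i ∈ U (e k p (τ (α i) k)) :=
    (((eventually_gt_atTop l).and (eventually_injective_filter_range hαinj)).filter_mono h𝒰).and
      (eventually_all.2 fun i => by simpa only [hαy] using hxe (α i) (hα i))
  obtain ⟨k, ⟨hlk, hinj⟩, hp⟩ := hev.exists
  choose p hp hyp using hp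
  exact hfree k l hlk p _ hp (fun i => hτ (α i) k) hinj y hyp

theorem main_free_baire_polish {X : Type} [TopologicalSpace X] [PolishSpace X]
    {ι : Type} [Countable ι] (n : ι → ℕ) (hn : ∀ i, 1 ≤ n i)
    (R : ∀ i, Set (Fin (n i) → X)) (hR : ∀ i, IsMeagre (R i)) :
    ∃ F : Set X, Dense F ∧ BaireSpace F ∧
      ∀ i (x : Fin (n i) → X), Function.Injective x → (∀ k, x k ∈ F) → x ∉ R i := by
  rcases isEmpty_or_nonempty X with hX | hX
  · exact ⟨∅, fun x => isEmptyElim x, ⟨fun _ _ _ x => isEmptyElim x⟩,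
      fun i x => isEmptyElim (x ⟨0, hn i⟩)⟩
  choose S hSn hSc hRS using fun i => isMeagre_iff_countable_union_isNowhereDense.1 (hR i)
  let T : Set (Σ m, Set (Fin m → X)) := insert ⟨0, ∅⟩ (⋃ i, Sigma.mk (n i) '' S i)
  have hTc : T.Countable := (countable_iUnion fun i => (hSc i).image _).insert _
  obtain ⟨N, hN⟩ := hTc.exists_eq_range (insert_nonempty _ _)
  have hNn : ∀ l, IsNowhereDense (N l).2 := fun l => by
    have hl : N l ∈ T := hN ▸ mem_range_self l
    rcases hl with hl | hl
    · rw [hl]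
      exact isNowhereDense_empty
    · obtain ⟨i, t, ht, hl⟩ := mem_iUnion.1 hl
      rw [← hl]
      exact hSn i t ht
  obtain ⟨F, hdense, hbaire, hfree⟩ := exists_dense_baire_free_of_isNowhereDense N hNn
  refine ⟨F, hdense, hbaire, fun i x hx hxF hxR => ?_⟩
  obtain ⟨t, ht, hxt⟩ := hRS i hxR
  have hmem : (⟨n i, t⟩ : Σ m, Set (Fin m → X)) ∈ range N :=
    hN ▸ mem_insert_of_mem _ (mem_iUnion.2 ⟨i, mem_image_of_mem _ ht⟩)
  obtain ⟨l, hl⟩ := hmem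
  have hfree_l := hfree l
  rw [hl] at hfree_l
  exact hfree_l x hx hxF hxt
end
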